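/- arXiv:math-ph/0002049 — 5 statements merged into one kernel-verified Lean document; each statement's English description precedes it below -/
import Mathlib

section
/- Kraus' characterization of completely positive maps (finite dimension): a linear map Φ : M_n(ℂ) → M_m(ℂ) is completely positive if and only if there exist k ∈ ℕ and matrices S_1, …, S_k, each S_j an n×m complex matrix, such that Φ(A) = Σ_{j=1}^k S_j* A S_j for all A ∈ M_n(ℂ). -/
open scoped ComplexOrder Matrix

/-- A map `Φ` between complex matrix algebras is *completely positive* if for every `k` and
every positive semidefinite block matrix `(A a b)_{a,b ∈ Fin k}`, the block matrix
`(Φ (A a b))_{a,b ∈ Fin k}` is positive semidefinite. -/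
def IsCompletelyPositive {n m : ℕ}
    (Φ : Matrix (Fin n) (Fin n) ℂ → Matrix (Fin m) (Fin m) ℂ) : Prop :=
  ∀ (k : ℕ) (A : Fin k → Fin k → Matrix (Fin n) (Fin n) ℂ),
    (Matrix.of fun p q : Fin k × Fin n => A p.1 q.1 p.2 q.2).PosSemidef →
    (Matrix.of fun p q : Fin k × Fin m => Φ (A p.1 q.1) p.2 q.2).PosSemidef

/-- **Kraus' theorem**: a linear map between complex matrix algebras is completely positive
if and only if it has a Kraus decomposition `Φ(A) = ∑ j, (S j)ᴴ * A * S j`. -/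
theorem isCompletelyPositive_iff_exists_kraus_decomposition
    {n m : ℕ} (Φ : Matrix (Fin n) (Fin n) ℂ →ₗ[ℂ] Matrix (Fin m) (Fin m) ℂ) :
    IsCompletelyPositive (⇑Φ) ↔
      ∃ (k : ℕ) (S : Fin k → Matrix (Fin n) (Fin m) ℂ),
        ∀ A, Φ A = ∑ j, (S j)ᴴ * A * S j := by
  constructor
  · intro h
    have hin : (Matrix.of fun p q : Fin n × Fin n =>
        (Matrix.single p.1 q.1 (1 : ℂ)) p.2 q.2).PosSemidef := by
      have := Matrix.posSemidef_vecMulVec_self_star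
        (fun p : Fin n × Fin n => if p.1 = p.2 then (1 : ℂ) else 0)
      convert this using 1
      ext p q
      simp only [Matrix.of_apply, Matrix.single_apply, Matrix.vecMulVec_apply, Pi.star_apply]
      by_cases h1 : p.1 = p.2 <;> by_cases h2 : q.1 = q.2 <;> simp [h1, h2]
    have hC := h n (fun a b => Matrix.single a b (1 : ℂ)) hin
    obtain ⟨k, v, hv⟩ := Matrix.posSemidef_iff_eq_sum_vecMulVec.mp hC
    refine ⟨k, fun l => Matrix.of fun a i => star (v l (a, i)), fun A => ?_⟩
    have hE : ∀ a b i j, Φ (Matrix.single a b (1 : ℂ)) i j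
        = ∑ l, v l (a, i) * star (v l (b, j)) := by
      intro a b i j
      have := congrFun (congrFun hv (a, i)) (b, j)
      simpa [Matrix.sum_apply, Matrix.vecMulVec_apply] using this
    have hA : Φ A = ∑ a, ∑ b, A a b • Φ (Matrix.single a b (1 : ℂ)) := by
      conv_lhs => rw [Matrix.matrix_eq_sum_single A]
      simp only [map_sum]
      refine Finset.sum_congr rfl fun a _ => Finset.sum_congr rfl fun b _ => ?_
      rw [← map_smul, Matrix.smul_single, smul_eq_mul, mul_one]
    rw [hA]
    ext i j
    simp only [Matrix.sum_apply, Matrix.smul_apply, hE, Matrix.mul_apply,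
      Matrix.conjTranspose_apply, Matrix.of_apply, star_star, smul_eq_mul,
      Finset.mul_sum, Finset.sum_mul]
    rw [Finset.sum_comm]
    conv_lhs => enter [2, b]; rw [Finset.sum_comm]
    rw [Finset.sum_comm]
    refine Finset.sum_congr rfl fun l _ => Finset.sum_congr rfl fun b _ =>
      Finset.sum_congr rfl fun a _ => ?_
    ring
  · rintro ⟨r, S, hS⟩ k A hA
    have key : (Matrix.of fun p q : Fin k × Fin m => Φ (A p.1 q.1) p.2 q.2) =
        ∑ l, (Matrix.of fun (p : Fin k × Fin n) (q : Fin k × Fin m) =>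
            if p.1 = q.1 then S l p.2 q.2 else 0)ᴴ *
          (Matrix.of fun p q : Fin k × Fin n => A p.1 q.1 p.2 q.2) *
          (Matrix.of fun (p : Fin k × Fin n) (q : Fin k × Fin m) =>
            if p.1 = q.1 then S l p.2 q.2 else 0) := by
      ext ⟨a, i⟩ ⟨b, j⟩
      simp only [Matrix.of_apply, hS, Matrix.sum_apply]
      refine Finset.sum_congr rfl fun l _ => ?_
      simp only [Matrix.mul_apply, Matrix.conjTranspose_apply, Matrix.of_apply,
        Fintype.sum_prod_type, apply_ite star, star_zero, ite_mul, mul_ite, zero_mul, mul_zero]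
      rw [Finset.sum_eq_single b (by intro c _ hc; simp [hc]) (by simp)]
      refine Finset.sum_congr rfl fun y _ => ?_
      rw [if_pos rfl, Finset.sum_eq_single a (by intro c _ hc; simp [hc]) (by simp)]
      simp
    rw [key]
    exact Matrix.posSemidef_sum _ fun l _ => hA.conjTranspose_mul_mul_same _
end

section
/- Any positive map on an abelian (finite-dimensional commutative) C*-algebra is completely positive: let Φ : (Fin m → ℂ) → M_n(ℂ) be a linear map such that Φ(f) is positive semidefinite whenever f takes only nonnegative real values. Then for every k ∈ ℕ and every family (f_{ab})_{a,b ∈ Fin k} of elements of Fin m → ℂ such that for each coordinate i ∈ Fin m the k×k matrix (f_{ab}(i))_{a,b} is positive semidefinite, the block matrix (Φ(f_{ab}))_{a,b ∈ Fin k} is positive semidefinite in M_{kn}(ℂ). -/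
open scoped ComplexOrder Matrix

/-- **Positive maps on abelian C*-algebras are completely positive.**
Let `Φ : (Fin m → ℂ) → Mₙ(ℂ)` be linear and positive, i.e. `Φ f` is positive semidefinite
whenever `f` takes nonnegative real values (in the sense of the complex order, `0 ≤ f i`).
Then for every `k` and every family `(f a b)_{a,b ∈ Fin k}` of functions that is positive as
an element of `M_k(C(Fin m))` (meaning `(f a b i)_{a,b}` is positive semidefinite for each
coordinate `i`), the block matrix `(Φ (f a b))_{a,b}` is positive semidefinite. -/
theorem posSemidef_blockMatrix_of_positive_linearMap_on_abelian
    {m n : ℕ} (Φ : (Fin m → ℂ) →ₗ[ℂ] Matrix (Fin n) (Fin n) ℂ)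
    (hpos : ∀ f : Fin m → ℂ, (∀ i, 0 ≤ f i) → (Φ f).PosSemidef) :
    ∀ (k : ℕ) (f : Fin k → Fin k → (Fin m → ℂ)),
      (∀ i : Fin m, (Matrix.of fun a b : Fin k => f a b i).PosSemidef) →
      (Matrix.of fun p q : Fin k × Fin n => Φ (f p.1 q.1) p.2 q.2).PosSemidef := by
  intro k f hf
  have key : (Matrix.of fun p q : Fin k × Fin n => Φ (f p.1 q.1) p.2 q.2) =
      ∑ i : Fin m, Matrix.kroneckerMap (· * ·) (Matrix.of fun a b : Fin k => f a b i)
        (Φ (Pi.single i 1)) := by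
    ext p q
    have h : f p.1 q.1 = ∑ i : Fin m, f p.1 q.1 i • (Pi.single i 1 : Fin m → ℂ) :=
      pi_eq_sum_univ' (f p.1 q.1) |>.trans (by
        refine Finset.sum_congr rfl fun i _ => ?_
        congr 1)
    rw [Matrix.of_apply, h, map_sum, Matrix.sum_apply, Matrix.sum_apply]
    refine Finset.sum_congr rfl fun i _ => ?_
    simp [Matrix.kroneckerMap_apply]
  rw [key]
  refine Matrix.posSemidef_sum _ fun i _ => (hf i).kronecker (hpos _ fun j => ?_)
  by_cases hj : j = i
  · subst hj
    simp
  · simp [hj]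
end

section
/- Any stochastic map that is invertible with stochastic inverse is (anti-)unitarily implemented: let T : M_n(ℂ) → M_n(ℂ) be a linear bijection such that both T and its inverse T⁻¹ map positive semidefinite matrices to positive semidefinite matrices and preserve the trace. Then there exists a unitary matrix U ∈ M_n(ℂ) such that either T(A) = U A U* for all A ∈ M_n(ℂ), or T(A) = U Aᵀ U* for all A ∈ M_n(ℂ) (Aᵀ the transpose). -/
open scoped ComplexOrder Matrix

namespace Stoch
open Matrix

/-- Rank-one matrices are extremal in the positive semidefinite cone. -/
lemma extremal {n : ℕ} (v : Fin n → ℂ) (B : Matrix (Fin n) (Fin n) ℂ) (hB : B.PosSemidef)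
    (hvB : (vecMulVec v (star v) - B).PosSemidef) :
    ∃ c : ℝ, 0 ≤ c ∧ B = (c : ℂ) • vecMulVec v (star v) := by
  have key : ∀ x, star v ⬝ᵥ x = 0 → B *ᵥ x = 0 := by
    intro x hx
    rw [← hB.dotProduct_mulVec_zero_iff]
    have h1 := hB.dotProduct_mulVec_nonneg x
    have h2 := hvB.dotProduct_mulVec_nonneg x
    rw [sub_mulVec, vecMulVec_mulVec, hx] at h2
    simp at h2
    exact le_antisymm h2 h1
  by_cases hv : v = 0
  · refine ⟨0, le_rfl, ?_⟩
    subst hv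
    apply Matrix.ext_of_mulVec_single
    intro i
    rw [key _ (by simp)]
    ext; simp
  have hs : star v ⬝ᵥ v ≠ 0 := by simpa [dotProduct_star_self_eq_zero] using hv
  have hs0 : 0 ≤ star v ⬝ᵥ v := dotProduct_star_self_nonneg v
  obtain ⟨s, hs'⟩ : ∃ s : ℝ, star v ⬝ᵥ v = s := ⟨_, (RCLike.nonneg_iff_exists_ofReal.1 hs0).choose_spec.2.symm⟩
  have h0 := hB.dotProduct_mulVec_nonneg v
  obtain ⟨t, ht0, ht⟩ : ∃ t : ℝ, 0 ≤ t ∧ star v ⬝ᵥ (B *ᵥ v) = t := by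
    obtain ⟨t, h1, h2⟩ := RCLike.nonneg_iff_exists_ofReal.1 h0
    exact ⟨t, h1, h2.symm⟩
  have hs2 : s ≠ 0 := by rintro rfl; simp [hs'] at hs
  have h1 : ∀ y, (s : ℂ) • (B *ᵥ y) = (star v ⬝ᵥ y) • (B *ᵥ v) := by
    intro y
    have := key ((s : ℂ) • y - (star v ⬝ᵥ y) • v) (by
      rw [dotProduct_sub, dotProduct_smul, dotProduct_smul, hs']; simp [mul_comm])
    rw [mulVec_sub, mulVec_smul, mulVec_smul] at this
    exact sub_eq_zero.1 this
  have h2 : (s : ℂ) • B = vecMulVec (B *ᵥ v) (star v) := by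
    apply Matrix.ext_of_mulVec_single
    intro i
    rw [smul_mulVec, h1, vecMulVec_mulVec]
    simp
  have h3 : (s : ℂ) • B = vecMulVec v (star (B *ᵥ v)) := by
    have := congrArg conjTranspose h2
    rw [conjTranspose_smul, hB.1, conjTranspose_vecMulVec] at this
    simpa using this
  have h4 : (s : ℂ) • (B *ᵥ v) = (t : ℂ) • v := by
    rw [← smul_mulVec, h3, vecMulVec_mulVec]
    have : star (B *ᵥ v) ⬝ᵥ v = (t : ℂ) := by
      rw [star_mulVec, hB.1, ← dotProduct_mulVec, ht]
    rw [this]; simp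
  refine ⟨t / s ^ 2, by positivity, ?_⟩
  have h5 : (s : ℂ) • (s : ℂ) • B = (t : ℂ) • vecMulVec v (star v) := by
    rw [h2, ← smul_vecMulVec, h4, smul_vecMulVec]
  have hsc : (s : ℂ) ≠ 0 := by exact_mod_cast hs2
  have h6 : B = ((s : ℂ) ^ 2)⁻¹ • (s : ℂ) • (s : ℂ) • B := by
    rw [smul_smul, smul_smul, show ((s : ℂ) ^ 2)⁻¹ * s * s = 1 by field_simp, one_smul]
  rw [h6, h5, smul_smul]
  congr 1
  push_cast
  field_simp

/-- A PSD-order isomorphism sends rank-one PSD matrices to rank-one PSD matrices. -/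
lemma rank_one {n : ℕ} (T : Matrix (Fin n) (Fin n) ℂ ≃ₗ[ℂ] Matrix (Fin n) (Fin n) ℂ)
    (hTpos : ∀ A : Matrix (Fin n) (Fin n) ℂ, A.PosSemidef → (T A).PosSemidef)
    (hTinvPos : ∀ A : Matrix (Fin n) (Fin n) ℂ, A.PosSemidef → (T.symm A).PosSemidef)
    (v : Fin n → ℂ) : ∃ w, T (vecMulVec v (star v)) = vecMulVec w (star w) := by
  obtain ⟨m, r, hr⟩ := Matrix.posSemidef_iff_eq_sum_vecMulVec.mp
    (hTpos _ (posSemidef_vecMulVec_self_star v))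
  by_cases h : ∀ k, r k = 0
  · exact ⟨0, by rw [hr]; simp [h]⟩
  push Not at h
  obtain ⟨k, hk⟩ := h
  obtain ⟨c, hc0, hc⟩ := extremal v (T.symm (vecMulVec (r k) (star (r k))))
    (hTinvPos _ (posSemidef_vecMulVec_self_star _)) (by
      have : vecMulVec v (star v) - T.symm (vecMulVec (r k) (star (r k)))
        = T.symm (T (vecMulVec v (star v)) - vecMulVec (r k) (star (r k))) := by simp
      rw [this, hr, ← Finset.sum_erase_add _ _ (Finset.mem_univ k), add_sub_cancel_right]
      exact hTinvPos _ (posSemidef_sum _ fun i _ => posSemidef_vecMulVec_self_star _))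
  have h1 : vecMulVec (r k) (star (r k)) = (c : ℂ) • T (vecMulVec v (star v)) := by
    rw [← map_smul, ← hc]; simp
  have hcne : c ≠ 0 := by
    rintro rfl
    simp [hk] at h1
  refine ⟨((Real.sqrt c)⁻¹ : ℂ) • r k, ?_⟩
  rw [star_smul, smul_vecMulVec, vecMulVec_smul, h1, smul_smul, smul_smul]
  have : ((Real.sqrt c)⁻¹ : ℂ) * star ((Real.sqrt c)⁻¹ : ℂ) * (c : ℂ) = 1 := by
    have : (Real.sqrt c)⁻¹ * (Real.sqrt c)⁻¹ * c = 1 := by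
      rw [← mul_inv, Real.mul_self_sqrt hc0, inv_mul_cancel₀ hcne]
    simp only [star_inv₀, RCLike.star_def, Complex.conj_ofReal]
    exact_mod_cast this
  rw [this, one_smul]

/-- `v v* ≤ |v|² 1`. -/
lemma le_one {n : ℕ} (v : Fin n → ℂ) :
    ((star v ⬝ᵥ v) • (1 : Matrix (Fin n) (Fin n) ℂ) - vecMulVec v (star v)).PosSemidef := by
  set c := star v ⬝ᵥ v with hc
  have hs0 : 0 ≤ c := dotProduct_star_self_nonneg v
  by_cases h : c = 0
  · have hv : v = 0 := by simpa [hc, dotProduct_star_self_eq_zero] using h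
    simp [h, hv, PosSemidef.zero]
  set P := c • (1 : Matrix (Fin n) (Fin n) ℂ) - vecMulVec v (star v) with hP
  have hstar : star c = c := (IsSelfAdjoint.of_nonneg hs0)
  have hH : Pᴴ = P := by
    rw [hP, conjTranspose_sub, conjTranspose_smul, conjTranspose_vecMulVec, hstar]; simp
  have hPP : P * Pᴴ = c • P := by
    rw [hH]
    simp only [hP, mul_sub, sub_mul, smul_mul, one_mul, mul_one, vecMulVec_mul_vecMulVec, ← hc,
      Matrix.smul_mul, Matrix.mul_smul, smul_sub, vecMulVec_smul]
    abel
  have : P = c⁻¹ • (P * Pᴴ) := by rw [hPP, smul_smul, inv_mul_cancel₀ h, one_smul]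
  rw [this]
  exact (posSemidef_self_mul_conjTranspose P).smul (inv_nonneg_of_nonneg hs0)

lemma exists_W {n : ℕ} (T : Matrix (Fin n) (Fin n) ℂ ≃ₗ[ℂ] Matrix (Fin n) (Fin n) ℂ)
    (hTpos : ∀ A : Matrix (Fin n) (Fin n) ℂ, A.PosSemidef → (T A).PosSemidef)
    (hTinvPos : ∀ A : Matrix (Fin n) (Fin n) ℂ, A.PosSemidef → (T.symm A).PosSemidef) :
    ∃ W : Matrix (Fin n) (Fin n) ℂ, IsUnit W.det ∧
      ∀ i, T (Matrix.single i i 1) = W * Matrix.single i i 1 * Wᴴ := by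
  choose w hw using fun i : Fin n => rank_one T hTpos hTinvPos (Pi.single i 1)
  have hE : ∀ i : Fin n, vecMulVec (Pi.single i (1 : ℂ)) (star (Pi.single i (1 : ℂ)))
      = Matrix.single i i 1 := by
    intro i
    ext a b
    simp only [vecMulVec_apply, Matrix.single_apply, Pi.single_apply, Pi.star_apply]
    by_cases h1 : a = i <;> by_cases h2 : b = i <;> simp [h1, h2, eq_comm (a := i)]
  let W : Matrix (Fin n) (Fin n) ℂ := Matrix.of fun a i => w i a
  have hWi : ∀ i, T (Matrix.single i i 1) = W * Matrix.single i i 1 * Wᴴ := by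
    intro i
    rw [← hE, hw, mul_vecMulVec, vecMulVec_mul]
    congr 1
    · ext a; simp [W]
    · ext a; simp [W]
  refine ⟨W, ?_, hWi⟩
  have hT1 : T 1 = W * Wᴴ := by
    have : (1 : Matrix (Fin n) (Fin n) ℂ) = ∑ i, Matrix.single i i 1 := by
      ext a b
      simp [Matrix.sum_apply, Matrix.single_apply, Matrix.one_apply, ite_and]
    rw [this, map_sum]
    simp_rw [hWi]
    rw [← Finset.sum_mul, ← Finset.mul_sum, ← this, mul_one]
  rw [isUnit_iff_ne_zero]
  intro hdet
  obtain ⟨x, hx, hx0⟩ := exists_vecMul_eq_zero_iff.2 hdet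
  have hx1 : Wᴴ *ᵥ (star x) = 0 := by
    rw [mulVec_conjTranspose]; simp [hx0]
  obtain ⟨v, hv⟩ := rank_one T.symm hTinvPos (by simpa using hTpos) (star x)
  have := (hTpos _ (le_one v)).dotProduct_mulVec_nonneg (star x)
  rw [← hv, map_sub, map_smul, hT1, LinearEquiv.apply_symm_apply, sub_mulVec, smul_mulVec,
    ← mulVec_mulVec, hx1, vecMulVec_mulVec] at this
  have hq0 : 0 ≤ star (star x) ⬝ᵥ star x := dotProduct_star_self_nonneg (star x)
  have hq : star (star x) ⬝ᵥ star x ≠ 0 := by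
    rw [Ne, dotProduct_star_self_eq_zero]; simpa using hx
  have hq1 := lt_of_le_of_ne hq0 hq.symm
  have hq2 := mul_pos hq1 hq1
  rw [mulVec_zero, smul_zero, zero_sub, dotProduct_neg, op_smul_eq_smul, dotProduct_smul,
    smul_eq_mul] at this
  have := lt_of_lt_of_le hq2 (neg_nonneg.1 this)
  exact lt_irrefl _ this

lemma scalar_diag (a a' : ℂ) (p q : ℝ) (hpq : (p = 0 ∧ q ≤ 1) ∨ (p = 1 ∧ q = 0))
    (h : ∀ z : ℂ, 0 ≤ (p : ℂ) + star z * a + z * a' + z * star z * q) : a = 0 ∧ a' = 0 := by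
  have e1 := (Complex.le_def.1 (h 1)).2
  have e2 := (Complex.le_def.1 (h Complex.I)).2
  simp at e1 e2
  have hre : a'.re = a.re := by linarith
  have him : a'.im = -a.im := by linarith
  have e3 : ∀ t : ℝ, 0 ≤ p - 2 * t * (a.re ^ 2 + a.im ^ 2)
      + t ^ 2 * (a.re ^ 2 + a.im ^ 2) * q := by
    intro t
    have := (Complex.le_def.1 (h (-t * a))).1
    simp [hre, him] at this
    nlinarith [this]
  have hN : a.re ^ 2 + a.im ^ 2 = 0 := by
    set N := a.re ^ 2 + a.im ^ 2 with hN
    have hN0 : 0 ≤ N := by positivity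
    rcases hpq with ⟨rfl, hq⟩ | ⟨rfl, rfl⟩
    · have := e3 (1 / 2)
      nlinarith
    · by_contra hne
      have := e3 (1 / N)
      have h3 : 1 / N * N = 1 := by field_simp
      rw [mul_assoc, h3] at this
      norm_num at this
  have hr : a.re = 0 := by nlinarith [sq_nonneg a.re, sq_nonneg a.im]
  have hi : a.im = 0 := by nlinarith [sq_nonneg a.re, sq_nonneg a.im]
  constructor <;> apply Complex.ext <;> simp [hr, hi, hre, him]

lemma scalar_pair (b c : ℂ)
    (h : ∀ z : ℂ, Complex.normSq (star z * b + z * c) = Complex.normSq z) :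
    (b = 0 ∨ c = 0) ∧ (b ≠ 0 ∨ c ≠ 0) := by
  have e1 := h 1
  have e2 := h Complex.I
  have e3 := h (1 + Complex.I)
  simp [Complex.normSq_apply] at e1 e2 e3
  have hre : b.re * c.re + b.im * c.im = 0 := by linarith
  have him : b.im * c.re - b.re * c.im = 0 := by linarith
  constructor
  · by_contra! hbc
    have : Complex.normSq b * Complex.normSq c = 0 := by
      simp only [Complex.normSq_apply]
      have : (b.re * b.re + b.im * b.im) * (c.re * c.re + c.im * c.im) =
        (b.re * c.re + b.im * c.im) ^ 2 + (b.im * c.re - b.re * c.im) ^ 2 := by ring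
      rw [this, hre, him]; simp
    simp [hbc.1, hbc.2] at this
  · by_contra! hbc
    simp [hbc.1, hbc.2] at e1

lemma expand {n : ℕ} (S : Matrix (Fin n) (Fin n) ℂ →ₗ[ℂ] Matrix (Fin n) (Fin n) ℂ)
    (i j : Fin n) (z : ℂ) :
    S (vecMulVec (Pi.single i 1 + Pi.single j z) (star (Pi.single i 1 + Pi.single j z))) =
      S (single i i 1) + star z • S (single i j 1) + z • S (single j i 1)
        + (z * star z) • S (single j j 1) := by
  simp only [← map_smul, ← map_add]
  congr 1
  ext a b
  have e1 : ∀ (i j a b : Fin n), single i j (1 : ℂ) a b =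
      (if a = i then 1 else 0) * (if b = j then 1 else 0) := by
    intro i j a b
    rw [Matrix.single_apply]
    by_cases h1 : i = a <;> by_cases h2 : j = b <;> simp [h1, h2, eq_comm (a := a), eq_comm (a := b)]
  have e2 : ∀ (j a : Fin n) (z : ℂ), (Pi.single j z : Fin n → ℂ) a
      = z * (if a = j then 1 else 0) := by
    intro j a z
    rw [Pi.single_apply]
    split_ifs <;> simp
  have e3 : ∀ (j a : Fin n), star (if a = j then (1 : ℂ) else 0) = if a = j then 1 else 0 := by
    intro j a
    split_ifs <;> simp
  simp only [vecMulVec_apply, e1, e2, Pi.star_apply, Pi.add_apply,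
    Matrix.add_apply, Matrix.smul_apply, star_add, star_mul, star_one, e3, smul_eq_mul]
  ring

section
variable {n : ℕ} (S : Matrix (Fin n) (Fin n) ℂ →ₗ[ℂ] Matrix (Fin n) (Fin n) ℂ)

lemma diag_basis (h1 : ∀ i, S (single i i 1) = single i i 1)
    (h2 : ∀ v, ∃ w, S (vecMulVec v (star v)) = vecMulVec w (star w))
    (i j k : Fin n) (hij : i ≠ j) : S (single i j 1) k k = 0 := by
  refine (scalar_diag (S (single i j 1) k k) (S (single j i 1) k k)
    (if i = k then 1 else 0) (if j = k then 1 else 0) ?_ ?_).1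
  · by_cases hi : i = k
    · right; subst hi; simp [hij.symm]
    · left; simp only [hi, if_false, true_and]; split_ifs <;> norm_num
  · intro z
    obtain ⟨w, hw⟩ := h2 (Pi.single i 1 + Pi.single j z)
    rw [expand, h1, h1] at hw
    have := congrFun (congrFun hw k) k
    simp only [Matrix.add_apply, Matrix.smul_apply, smul_eq_mul, Matrix.single_apply, and_self,
      vecMulVec_apply, Pi.star_apply] at this
    have hc : ∀ l : Fin n, (((if l = k then 1 else 0 : ℝ)) : ℂ) = if l = k then 1 else 0 := by
      intro l; split_ifs <;> simp
    rw [hc, hc, this]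
    exact mul_star_self_nonneg (w k)

lemma diag_eq (h1 : ∀ i, S (single i i 1) = single i i 1)
    (h2 : ∀ v, ∃ w, S (vecMulVec v (star v)) = vecMulVec w (star w))
    (k : Fin n) (A : Matrix (Fin n) (Fin n) ℂ) : S A k k = A k k := by
  induction A using Matrix.induction_on' with
  | h_zero => simp
  | h_add p q hp hq => simp [hp, hq]
  | h_std_basis i j x =>
    have : single i j x = x • single i j (1 : ℂ) := by simp
    rw [this, map_smul, Matrix.smul_apply, Matrix.smul_apply]
    congr 1
    by_cases hij : i = j
    · subst hij; rw [h1]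
    · rw [diag_basis S h1 h2 i j k hij, Matrix.single_apply, if_neg]
      rintro ⟨rfl, rfl⟩; exact hij rfl

lemma normSq_w (h1 : ∀ i, S (single i i 1) = single i i 1)
    (h2 : ∀ v, ∃ w, S (vecMulVec v (star v)) = vecMulVec w (star w)) (v w : Fin n → ℂ)
    (hw : S (vecMulVec v (star v)) = vecMulVec w (star w)) (k : Fin n) :
    w k * star (w k) = v k * star (v k) := by
  have := diag_eq S h1 h2 k (vecMulVec v (star v))
  rw [hw] at this
  exact this

lemma off_basis (h1 : ∀ i, S (single i i 1) = single i i 1)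
    (h2 : ∀ v, ∃ w, S (vecMulVec v (star v)) = vecMulVec w (star w))
    (i j a b : Fin n) (hab : a ≠ b) (hx : ¬ (i = a ∧ j = b)) (hy : ¬ (i = b ∧ j = a)) :
    S (single i j 1) a b = 0 := by
  by_cases hij : i = j
  · subst hij; rw [h1, Matrix.single_apply, if_neg hx]
  have hz : ∀ z : ℂ, star z * S (single i j 1) a b + z * S (single j i 1) a b = 0 := by
    intro z
    obtain ⟨w, hw⟩ := h2 (Pi.single i 1 + Pi.single j z)
    have hk : ∀ k, i ≠ k → j ≠ k → w k = 0 := by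
      intro k hik hjk
      have := normSq_w S h1 h2 _ _ hw k
      simpa [Pi.single_apply, hik.symm, hjk.symm] using this
    rw [expand, h1, h1] at hw
    have := congrFun (congrFun hw a) b
    have h0 : w a * star (w b) = 0 := by
      by_cases ha : i ≠ a ∧ j ≠ a
      · rw [hk a ha.1 ha.2, zero_mul]
      · rw [hk b (by grind) (by grind)]; simp
    simp only [Matrix.add_apply, Matrix.smul_apply, smul_eq_mul, Matrix.single_apply,
      vecMulVec_apply, Pi.star_apply, h0] at this
    rw [if_neg (by grind), if_neg (by grind)] at this
    simpa using this
  have e1 := hz 1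
  have e2 := hz Complex.I
  simp at e1 e2
  have e3 : Complex.I * (S (single j i 1) a b - S (single i j 1) a b) = 0 := by linear_combination e2
  have e4 := (mul_eq_zero.1 e3).resolve_left Complex.I_ne_zero
  linear_combination (e1 - e4) / 2

lemma off_eq (h1 : ∀ i, S (single i i 1) = single i i 1)
    (h2 : ∀ v, ∃ w, S (vecMulVec v (star v)) = vecMulVec w (star w))
    (a b : Fin n) (hab : a ≠ b) (A : Matrix (Fin n) (Fin n) ℂ) :
    S A a b = S (single a b 1) a b * A a b + S (single b a 1) a b * A b a := by
  induction A using Matrix.induction_on' with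
  | h_zero => simp
  | h_add p q hp hq => simp [hp, hq]; ring
  | h_std_basis i j x =>
    have : single i j x = x • single i j (1 : ℂ) := by simp
    rw [this, map_smul, Matrix.smul_apply, Matrix.smul_apply, Matrix.smul_apply]
    by_cases hx : i = a ∧ j = b
    · obtain ⟨rfl, rfl⟩ := hx
      simp [Matrix.single_apply, hab, mul_comm]
    by_cases hy : i = b ∧ j = a
    · obtain ⟨rfl, rfl⟩ := hy
      simp [Matrix.single_apply, hab.symm, mul_comm]
    rw [off_basis S h1 h2 i j a b hab hx hy]
    simp [Matrix.single_apply, hx, hy]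

lemma pair (h1 : ∀ i, S (single i i 1) = single i i 1)
    (h2 : ∀ v, ∃ w, S (vecMulVec v (star v)) = vecMulVec w (star w))
    (a b : Fin n) (hab : a ≠ b) :
    (S (single a b 1) a b = 0 ∨ S (single b a 1) a b = 0) ∧
    (S (single a b 1) a b ≠ 0 ∨ S (single b a 1) a b ≠ 0) := by
  apply scalar_pair
  intro z
  obtain ⟨w, hw⟩ := h2 (Pi.single a 1 + Pi.single b z)
  have ha := normSq_w S h1 h2 _ _ hw a
  have hb := normSq_w S h1 h2 _ _ hw b
  have := congrFun (congrFun hw a) b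
  rw [off_eq S h1 h2 a b hab] at this
  simp [vecMulVec_apply, Pi.single_apply, hab, hab.symm] at this ha hb
  have e : star z * S (single a b 1) a b + z * S (single b a 1) a b = w a * star (w b) := by
    simp only [RCLike.star_def]; rw [← this]; ring
  rw [e, Complex.normSq_mul, RCLike.star_def, Complex.normSq_conj]
  rw [Complex.mul_conj] at ha hb
  rw [Complex.mul_conj] at hb
  have ha' : Complex.normSq (w a) = 1 := by exact_mod_cast ha
  have hb' : Complex.normSq (w b) = Complex.normSq z := by exact_mod_cast hb
  rw [ha', hb', one_mul]

lemma sym (h1 : ∀ i, S (single i i 1) = single i i 1)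
    (h2 : ∀ v, ∃ w, S (vecMulVec v (star v)) = vecMulVec w (star w))
    (a b : Fin n) (hab : a ≠ b) (h : S (single a b 1) a b ≠ 0) : S (single b a 1) b a ≠ 0 := by
  intro h0
  have hp := (pair S h1 h2 a b hab).1.resolve_left h
  have key : ∀ z : ℂ, S (single a b 1) b a * star z = star (S (single a b 1) a b) * z := by
    intro z
    obtain ⟨w, hw⟩ := h2 (Pi.single a 1 + Pi.single b z)
    have e1 := congrFun (congrFun hw a) b
    have e2 := congrFun (congrFun hw b) a
    rw [off_eq S h1 h2 a b hab, hp] at e1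
    rw [off_eq S h1 h2 b a hab.symm, h0] at e2
    simp [vecMulVec_apply, Pi.single_apply, hab, hab.symm] at e1 e2
    have e3 := congrArg (starRingEnd ℂ) e1
    simp at e3
    simp only [RCLike.star_def]
    rw [e2, e3, mul_comm]
  have k1 := key 1
  have k2 := key Complex.I
  simp at k1 k2
  rw [k1] at k2
  have : Complex.I * (starRingEnd ℂ) (S (single a b 1) a b) = 0 := by
    linear_combination (-1 / 2) * k2
  simp [h] at this

lemma triple (h1 : ∀ i, S (single i i 1) = single i i 1)
    (h2 : ∀ v, ∃ w, S (vecMulVec v (star v)) = vecMulVec w (star w))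
    (a b c : Fin n) (hab : a ≠ b) (hbc : b ≠ c) (hac : a ≠ c)
    (h : S (single a b 1) a b ≠ 0) : S (single b c 1) b c ≠ 0 := by
  intro h0
  have hp := (pair S h1 h2 a b hab).1.resolve_left h
  have hq := (pair S h1 h2 b c hbc).2.resolve_left (by simpa using h0)
  have key : ∀ z : ℂ, z * star z = 1 →
      S (single a b 1) a b * star z * (S (single c b 1) b c * star z) =
      S (single a c 1) a c + S (single c a 1) a c := by
    intro z hz
    obtain ⟨w, hw⟩ := h2 (Pi.single a 1 + Pi.single b z + Pi.single c 1)
    have hb := normSq_w S h1 h2 _ _ hw b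
    have e1 := congrFun (congrFun hw a) b
    have e2 := congrFun (congrFun hw b) c
    have e3 := congrFun (congrFun hw a) c
    rw [off_eq S h1 h2 a b hab, hp] at e1
    rw [off_eq S h1 h2 b c hbc, h0] at e2
    rw [off_eq S h1 h2 a c hac] at e3
    simp [vecMulVec_apply, Pi.single_apply, hab, hab.symm, hbc, hbc.symm, hac, hac.symm]
      at e1 e2 e3 hb
    simp only [RCLike.star_def] at hz ⊢
    rw [hz] at hb
    rw [e1, e2, e3]
    linear_combination (w a * (starRingEnd ℂ) (w c)) * hb
  have k1 := key 1 (by simp)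
  have k2 := key Complex.I (by simp)
  rw [← k1] at k2
  simp at k2
  have : S (single a b 1) a b * S (single c b 1) b c = 0 := by
    linear_combination (-1 / 2) * k2 + 1 / 2 * S (single a b 1) a b * S (single c b 1) b c * (Complex.I_mul_I)
  simp [h, hq] at this

lemma all_pairs (h1 : ∀ i, S (single i i 1) = single i i 1)
    (h2 : ∀ v, ∃ w, S (vecMulVec v (star v)) = vecMulVec w (star w))
    (a b : Fin n) (hab : a ≠ b) (h : S (single a b 1) a b ≠ 0) (k l : Fin n) (hkl : k ≠ l) :
    S (single k l 1) k l ≠ 0 := by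
  have hs := sym S h1 h2
  have ht := triple S h1 h2
  by_cases hka : k = a
  · subst hka
    by_cases hlb : l = b
    · subst hlb; exact h
    · exact ht b k l hab.symm hkl (Ne.symm hlb) (hs _ _ hab h)
  by_cases hkb : k = b
  · subst hkb
    by_cases hla : l = a
    · subst hla; exact hs _ _ hab h
    · exact ht a k l hab hkl (Ne.symm hla) h
  have hbk := ht a b k hab (Ne.symm hkb) (Ne.symm hka) h
  by_cases hlb : l = b
  · subst hlb; exact hs _ _ (Ne.symm hkb) hbk
  · exact ht b k l (Ne.symm hkb) hkl (Ne.symm hlb) hbk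

lemma struct (h1 : ∀ i, S (single i i 1) = single i i 1)
    (h2 : ∀ v, ∃ w, S (vecMulVec v (star v)) = vecMulVec w (star w)) :
    ∃ d : Matrix (Fin n) (Fin n) ℂ, (∀ A, S A = d * A * dᴴ) ∨ (∀ A, S A = d * Aᵀ * dᴴ) := by
  obtain ⟨w, hw⟩ := h2 1
  have hw' : ∀ a b, S (vecMulVec 1 (star 1)) a b = w a * star (w b) := fun a b => by
    rw [hw]; rfl
  have hn : ∀ k, w k * star (w k) = 1 := fun k => by
    simpa using normSq_w S h1 h2 _ _ hw k
  refine ⟨diagonal w, ?_⟩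
  by_cases hP : ∃ a b, a ≠ b ∧ S (single a b 1) a b ≠ 0
  · left
    obtain ⟨a, b, hab, h⟩ := hP
    intro A
    ext i j
    rw [diagonal_conjTranspose, mul_diagonal, diagonal_mul]
    by_cases hij : i = j
    · subst hij
      rw [diag_eq S h1 h2]
      have := hn i
      simp only [Pi.star_apply]
      linear_combination (-A i i) * this
    · have hz := (pair S h1 h2 i j hij).1.resolve_left (all_pairs S h1 h2 a b hab h i j hij)
      have e := hw' i j
      rw [off_eq S h1 h2 i j hij, hz] at e ⊢
      simp [vecMulVec_apply] at e ⊢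
      rw [e]; ring
  · right
    push Not at hP
    intro A
    ext i j
    rw [diagonal_conjTranspose, mul_diagonal, diagonal_mul]
    by_cases hij : i = j
    · subst hij
      rw [diag_eq S h1 h2]
      have := hn i
      simp only [Pi.star_apply, transpose_apply]
      linear_combination (-A i i) * this
    · have hz := hP i j hij
      have e := hw' i j
      rw [off_eq S h1 h2 i j hij, hz] at e ⊢
      simp [vecMulVec_apply] at e ⊢
      rw [e]; ring
end

end Stoch

/-- **Invertible stochastic maps are (anti-)unitarily implemented**: if `T` is a linear
bijection of `Mₙ(ℂ)` such that both `T` and `T⁻¹` are positivity-preserving and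
trace-preserving, then there is a unitary `U` with `T(A) = U A U*` for all `A`, or
`T(A) = U Aᵀ U*` for all `A`. -/
theorem stochastic_linear_bijection_with_stochastic_inverse_is_unitarily_implemented
    {n : ℕ} (T : Matrix (Fin n) (Fin n) ℂ ≃ₗ[ℂ] Matrix (Fin n) (Fin n) ℂ)
    (hTpos : ∀ A : Matrix (Fin n) (Fin n) ℂ, A.PosSemidef → (T A).PosSemidef)
    (hTinvPos : ∀ A : Matrix (Fin n) (Fin n) ℂ, A.PosSemidef → (T.symm A).PosSemidef)
    (hTtr : ∀ A : Matrix (Fin n) (Fin n) ℂ, (T A).trace = A.trace)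
    (hTinvTr : ∀ A : Matrix (Fin n) (Fin n) ℂ, (T.symm A).trace = A.trace) :
    ∃ U : Matrix (Fin n) (Fin n) ℂ, U ∈ Matrix.unitaryGroup (Fin n) ℂ ∧
      ((∀ A, T A = U * A * Uᴴ) ∨ (∀ A, T A = U * Aᵀ * Uᴴ)) := by
  obtain ⟨W, hWu, hW⟩ := Stoch.exists_W T hTpos hTinvPos
  have hWl : W⁻¹ * W = 1 := Matrix.nonsing_inv_mul W hWu
  have hWr : W * W⁻¹ = 1 := Matrix.mul_nonsing_inv W hWu
  have hWl' : Wᴴ * (W⁻¹)ᴴ = 1 := by rw [← Matrix.conjTranspose_mul, hWl, Matrix.conjTranspose_one]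
  have hWr' : (W⁻¹)ᴴ * Wᴴ = 1 := by rw [← Matrix.conjTranspose_mul, hWr, Matrix.conjTranspose_one]
  let S : Matrix (Fin n) (Fin n) ℂ →ₗ[ℂ] Matrix (Fin n) (Fin n) ℂ :=
    { toFun := fun A => W⁻¹ * T A * (W⁻¹)ᴴ
      map_add' := fun A B => by rw [map_add, mul_add, add_mul]
      map_smul' := fun c A => by
        rw [map_smul, Matrix.mul_smul, Matrix.smul_mul, RingHom.id_apply] }
  have hS : ∀ A, S A = W⁻¹ * T A * (W⁻¹)ᴴ := fun A => rfl
  have hTS : ∀ A, T A = W * S A * Wᴴ := by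
    intro A
    calc T A = (W * W⁻¹) * T A * ((W⁻¹)ᴴ * Wᴴ) := by rw [hWr, hWr', one_mul, mul_one]
      _ = W * S A * Wᴴ := by rw [hS]; simp only [mul_assoc]
  obtain ⟨d, hd⟩ := Stoch.struct S
    (by
      intro i
      rw [hS, hW]
      calc W⁻¹ * (W * Matrix.single i i 1 * Wᴴ) * (W⁻¹)ᴴ
          = (W⁻¹ * W) * Matrix.single i i 1 * (Wᴴ * (W⁻¹)ᴴ) := by simp only [mul_assoc]
        _ = _ := by rw [hWl, hWl', one_mul, mul_one])
    (by
      intro v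
      obtain ⟨w, hw⟩ := Stoch.rank_one T hTpos hTinvPos v
      refine ⟨W⁻¹ *ᵥ w, ?_⟩
      rw [hS, hw, Matrix.mul_vecMulVec, Matrix.vecMulVec_mul, Matrix.star_mulVec])
  refine ⟨W * d, ?_, ?_⟩
  · rw [Matrix.mem_unitaryGroup_iff', Matrix.star_eq_conjTranspose,
      Matrix.ext_iff_trace_mul_right]
    rcases hd with hd | hd
    · intro A
      rw [one_mul, ← hTtr A, hTS, hd, mul_assoc, Matrix.trace_mul_comm, Matrix.conjTranspose_mul]
      simp only [mul_assoc]
    · intro A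
      rw [one_mul, ← Matrix.trace_transpose A, ← hTtr Aᵀ, hTS, hd, Matrix.transpose_transpose,
        mul_assoc, Matrix.trace_mul_comm, Matrix.conjTranspose_mul]
      simp only [mul_assoc]
  · rcases hd with hd | hd
    · left; intro A
      rw [hTS, hd, Matrix.conjTranspose_mul]; simp only [mul_assoc]
    · right; intro A
      rw [hTS, hd, Matrix.conjTranspose_mul]; simp only [mul_assoc]
end

section
/- Stinespring dilation in finite dimensions: let Φ : M_n(ℂ) → M_m(ℂ) be a completely positive linear map. Then there exist k ≥ 1 and a complex matrix V with rows indexed by Fin n × Fin k and columns indexed by Fin m such that Φ(A) = V* (A ⊗ 1_k) V for all A ∈ M_n(ℂ), where A ⊗ 1_k denotes the Kronecker product of A with the k×k identity matrix (a matrix indexed by Fin n × Fin k). -/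
open scoped ComplexOrder Matrix Kronecker

/-- **Stinespring dilation in finite dimensions**: every completely positive linear map
`Φ : Mₙ(ℂ) → Mₘ(ℂ)` is of the form `Φ(A) = V* (A ⊗ 1ₖ) V` for some `k ≥ 1` and some
`nk × m` matrix `V`. -/
theorem exists_stinespring_dilation
    {n m : ℕ} (Φ : Matrix (Fin n) (Fin n) ℂ →ₗ[ℂ] Matrix (Fin m) (Fin m) ℂ)
    (hΦ : IsCompletelyPositive (⇑Φ)) :
    ∃ (k : ℕ), 1 ≤ k ∧ ∃ V : Matrix (Fin n × Fin k) (Fin m) ℂ,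
      ∀ A : Matrix (Fin n) (Fin n) ℂ,
        Φ A = Vᴴ * (A ⊗ₖ (1 : Matrix (Fin k) (Fin k) ℂ)) * V := by
  classical
  have h1 : (Matrix.of fun p q : Fin n × Fin n =>
      (Matrix.single p.1 q.1 (1 : ℂ) : Matrix (Fin n) (Fin n) ℂ) p.2 q.2).PosSemidef := by
    have h := Matrix.posSemidef_vecMulVec_self_star
      (fun p : Fin n × Fin n => if p.1 = p.2 then (1 : ℂ) else 0)
    convert h using 1
    ext p q
    simp only [Matrix.of_apply, Matrix.single_apply, Matrix.vecMulVec_apply, Pi.star_apply]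
    by_cases h1 : p.1 = p.2 <;> by_cases h2 : q.1 = q.2 <;> simp [h1, h2]
  have h2 := hΦ n (fun a b => Matrix.single a b 1) h1
  obtain ⟨B, hB⟩ : ∃ B : Matrix (Fin n × Fin m) (Fin n × Fin m) ℂ,
      (Matrix.of fun p q : Fin n × Fin m =>
        Φ (Matrix.single p.1 q.1 1) p.2 q.2) = Bᴴ * B := by
    open scoped MatrixOrder in
    exact CStarAlgebra.nonneg_iff_eq_star_mul_self.mp h2.nonneg
  have hB' : ∀ a b i j, Φ (Matrix.single a b 1) i j =
      ∑ r, star (B r (a, i)) * B r (b, j) := by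
    intro a b i j
    have := congrFun (congrFun hB (a, i)) (b, j)
    simpa [Matrix.mul_apply, Matrix.conjTranspose_apply] using this
  have key : ∀ (A : Matrix (Fin n) (Fin n) ℂ) i j, Φ A i j =
      ∑ a, ∑ b, A a b * ∑ r, star (B r (a, i)) * B r (b, j) := by
    intro A i j
    conv_lhs => rw [Matrix.matrix_eq_sum_single A]
    simp only [map_sum, Matrix.sum_apply]
    refine Finset.sum_congr rfl fun a _ => Finset.sum_congr rfl fun b _ => ?_
    rw [← hB', ← smul_eq_mul, ← Matrix.smul_apply, ← map_smul, Matrix.smul_single]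
    simp
  by_cases hk : 1 ≤ n * m
  · refine ⟨n * m, hk, Matrix.of fun p j => B (finProdFinEquiv.symm p.2) (p.1, j), ?_⟩
    intro A
    ext i j
    rw [key]
    simp only [Matrix.mul_apply, Matrix.conjTranspose_apply, Matrix.of_apply,
      Matrix.kroneckerMap_apply, Matrix.one_apply, Fintype.sum_prod_type (α₁ := Fin n)
      (α₂ := Fin (n * m)), mul_ite, mul_one, mul_zero, Finset.sum_ite_eq', Finset.sum_ite_eq,
      Finset.mem_univ, if_true, Finset.sum_mul]
    rw [Finset.sum_comm]
    refine Finset.sum_congr rfl fun b _ => ?_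
    rw [Finset.sum_comm]
    refine Finset.sum_congr rfl fun a _ => ?_
    rw [Finset.mul_sum, ← finProdFinEquiv.symm.sum_comp]
    refine Finset.sum_congr rfl fun r _ => ?_
    ring
  · refine ⟨1, le_rfl, 0, ?_⟩
    intro A
    have : n = 0 ∨ m = 0 := by
      rw [← Nat.mul_eq_zero]; omega
    ext i j
    rcases this with rfl | rfl
    · rw [key]; simp
    · exact i.elim0
end

section
/- Davies' dilation theorem (finite-dimensional system): let (T_t)_{t ≥ 0} be a one-parameter semigroup of completely positive unital linear maps on M_n(ℂ) (T_0 = id, T_{s+t} = T_s ∘ T_t, t ↦ T_t continuous, T_t(1) = 1). Then there exist a complex Hilbert space 𝓚, a unital star-algebra homomorphism π from M_n(ℂ) to the bounded operators on 𝓚, a linear isometry J : ℂ^n → 𝓚 (ℂ^n with the Euclidean inner product) intertwining the representations (π(A) J = J A as operators ℂ^n → 𝓚, where A acts on ℂ^n as a matrix), and a strongly continuous one-parameter group (V_t)_{t ∈ ℝ} of unitary operators on 𝓚 (V_0 = 1, V_{s+t} = V_s V_t, and t ↦ V_t x continuous for each x ∈ 𝓚), such that for every A ∈ M_n(ℂ)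 and every t ≥ 0, the operator on ℂ^n determined by the matrix T_t(A) equals J* V_t* π(A) V_t J. -/
open scoped ComplexOrder Matrix

attribute [local instance] Matrix.normedAddCommGroup Matrix.normedSpace

/-- The data of a Davies-type dilation of a family `T` of maps on `Mₙ(ℂ)`: a Hilbert space
`K`, a unital star-algebra representation `rep` of `Mₙ(ℂ)` on `K`, a linear isometry
`J : ℂⁿ → K` intertwining the representations, and a strongly continuous one-parameter
unitary group `V` on `K`, such that `T t A = J* ∘ (V t)* ∘ rep A ∘ V t ∘ J` for `t ≥ 0`. -/
structure DaviesDilation (n : ℕ)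
    (T : ℝ → (Matrix (Fin n) (Fin n) ℂ →L[ℂ] Matrix (Fin n) (Fin n) ℂ)) where
  K : Type
  [normedK : NormedAddCommGroup K]
  [innerK : InnerProductSpace ℂ K]
  [completeK : CompleteSpace K]
  rep : Matrix (Fin n) (Fin n) ℂ →⋆ₐ[ℂ] (K →L[ℂ] K)
  J : EuclideanSpace ℂ (Fin n) →ₗᵢ[ℂ] K
  intertwine : ∀ (A : Matrix (Fin n) (Fin n) ℂ) (x : EuclideanSpace ℂ (Fin n)),
    rep A (J x) = J (Matrix.toEuclideanLin A x)
  V : ℝ → (K →L[ℂ] K)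
  V_unitary : ∀ t : ℝ, V t ∈ unitary (K →L[ℂ] K)
  V_zero : V 0 = 1
  V_add : ∀ s t : ℝ, V (s + t) = V s * V t
  V_strongly_continuous : ∀ x : K, Continuous fun t : ℝ => V t x
  dilation : ∀ t : ℝ, 0 ≤ t → ∀ (A : Matrix (Fin n) (Fin n) ℂ)
      (x : EuclideanSpace ℂ (Fin n)),
    Matrix.toEuclideanLin (T t A) x
      = (ContinuousLinearMap.adjoint J.toContinuousLinearMap)
          ((ContinuousLinearMap.adjoint (V t)) (rep A (V t (J x))))


theorem kol {X : Type} (M : Matrix X X ℂ) (hM : M.PosSemidef) :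
    ∃ (L : Type) (_ : NormedAddCommGroup L) (_ : InnerProductSpace ℂ L) (_ : CompleteSpace L)
      (l : X → L), ∀ x y, inner ℂ (l x) (l y) = M x y := by
  let K : Matrix X X (ℂ →L[ℂ] ℂ) := Matrix.of fun x y => M x y • (1 : ℂ →L[ℂ] ℂ)
  have hK : K.PosSemidef := by
    have tf := RKHS.posSemidef_tfae (K := K)
    refine (tf.out 0 2 rfl rfl).mpr ⟨?_, fun v => ?_⟩
    · ext x y : 2
      simp [K, Matrix.conjTranspose_apply, ← hM.1.apply x y]
    · have h := hM.2 v
      rw [Finsupp.sum_comm]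
      have h2 := (Complex.le_def.1 h).1
      refine le_of_le_of_eq h2 ?_
      have : (v.sum fun i xi ↦ v.sum fun j xj ↦ star xi * M i j * xj)
        = star (v.sum fun y w ↦ v.sum fun x v ↦ (inner ℂ ((K y x) v) w)) := by
        simp only [Finsupp.sum, star_sum, K]
        refine Finset.sum_congr rfl fun i _ => Finset.sum_congr rfl fun j _ => ?_
        simp
        ring
      rw [this]
      exact Complex.conj_re _
  have : Fact K.PosSemidef := ⟨hK⟩
  refine ⟨RKHS.OfKernel K, inferInstance, inferInstance, inferInstance,
    fun x => RKHS.kerFun (RKHS.OfKernel K) x 1, fun x y => ?_⟩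
  rw [← RKHS.kernel_inner, RKHS.OfKernel.kernel_ofKernel]
  simp [K, ← hM.1.apply x y]

theorem min_kernel_aux {ι d : Type} [Fintype d] (s : ι → ℝ) (a : ι → d) (c : ι → ℂ) (N : ℕ) :
    ∀ (S : Finset ι) (_ : S.card = N) (Q : ℝ → Matrix d d ℂ)
      (_ : ∀ i ∈ S, (Q (s i)).PosSemidef)
      (_ : ∀ i ∈ S, ∀ j ∈ S, s i ≤ s j → (Q (s j) - Q (s i)).PosSemidef),
      0 ≤ ∑ i ∈ S, ∑ j ∈ S, star (c i) * Q (min (s i) (s j)) (a i) (a j) * c j := by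
  classical
  induction N with
  | zero => intro S hS Q _ _; rw [Finset.card_eq_zero] at hS; simp [hS]
  | succ N ih =>
    intro S hS Q h1 h2
    have hne : S.Nonempty := Finset.card_pos.1 (by omega)
    obtain ⟨i0, hi0, hmin⟩ := Finset.exists_min_image S s hne
    have key := ih (S.erase i0) (by rw [Finset.card_erase_of_mem hi0]; omega)
      (fun t => Q t - Q (s i0))
      (fun i hi => h2 i0 hi0 i (Finset.mem_of_mem_erase hi) (hmin i (Finset.mem_of_mem_erase hi)))
      (fun i hi j hj hij => by
        simpa using h2 i (Finset.mem_of_mem_erase hi) j (Finset.mem_of_mem_erase hj) hij)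
    have e1 : ∑ i ∈ S, ∑ j ∈ S, star (c i) * Q (min (s i) (s j)) (a i) (a j) * c j
      = ∑ i ∈ S, ∑ j ∈ S, star (c i) * Q (s i0) (a i) (a j) * c j
       + ∑ i ∈ S, ∑ j ∈ S, star (c i) * (Q (min (s i) (s j)) - Q (s i0)) (a i) (a j) * c j := by
      rw [← Finset.sum_add_distrib]
      refine Finset.sum_congr rfl fun i _ => ?_
      rw [← Finset.sum_add_distrib]
      refine Finset.sum_congr rfl fun j _ => ?_
      simp only [Matrix.sub_apply]; ring
    have e2 : ∑ i ∈ S, ∑ j ∈ S, star (c i) * (Q (min (s i) (s j)) - Q (s i0)) (a i) (a j) * c j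
      = ∑ i ∈ S.erase i0, ∑ j ∈ S.erase i0,
          star (c i) * (Q (min (s i) (s j)) - Q (s i0)) (a i) (a j) * c j := by
      refine (Finset.sum_erase (a := i0) S ?_).symm.trans
        (Finset.sum_congr rfl fun i hi => (Finset.sum_erase (a := i0) S ?_).symm)
      · refine Finset.sum_eq_zero fun j hj => ?_
        rw [min_eq_left (hmin j hj)]; simp
      · rw [min_eq_right (hmin i (Finset.mem_of_mem_erase hi))]; simp
    rw [e1, e2]
    refine add_nonneg ?_ key
    have := ((h1 i0 hi0).submatrix (fun i : S => a i)).dotProduct_mulVec_nonneg (fun i : S => c i)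
    refine le_of_le_of_eq this ?_
    rw [← Finset.sum_coe_sort S]
    simp only [dotProduct, Matrix.mulVec, Finset.mul_sum, Matrix.submatrix_apply, Pi.star_apply]
    refine Finset.sum_congr rfl fun i _ => ?_
    rw [← Finset.sum_coe_sort S]
    refine Finset.sum_congr rfl fun j _ => ?_
    ring

theorem min_kernel {d : Type} [Fintype d] (Q : ℝ → Matrix d d ℂ)
    (h0 : ∀ t, (Q t).PosSemidef) (h1 : ∀ s t, s ≤ t → (Q t - Q s).PosSemidef) :
    (Matrix.of fun p q : ℝ × d => Q (min p.1 q.1) p.2 q.2).PosSemidef := by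
  refine ⟨?_, fun x => ?_⟩
  · ext p q
    simp [Matrix.conjTranspose_apply, min_comm q.1 p.1, ← (h0 (min p.1 q.1)).1.apply p.2 q.2]
  · exact min_kernel_aux Prod.fst Prod.snd x _ x.support rfl Q (fun i _ => h0 _)
      (fun i _ j _ h => h1 _ _ h)

theorem matrix_exp_exists {n : ℕ} (G : Matrix (Fin n) (Fin n) ℂ) :
    ∃ E : ℝ → Matrix (Fin n) (Fin n) ℂ, E 0 = 1 ∧ (∀ s t, E (s + t) = E s * E t) ∧
      ∀ t i j, HasDerivAt (fun t => E t i j) ((G * E t) i j) t := by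
  let nr := Matrix.linftyOpNormedRing (n := Fin n) (α := ℂ)
  let _ := Matrix.linftyOpNormedAlgebra (n := Fin n) (α := ℂ) (R := ℝ)
  let _ := Matrix.linftyOpNormedAlgebra (n := Fin n) (α := ℂ) (R := ℂ)
  have hcs : @CompleteSpace (Matrix (Fin n) (Fin n) ℂ)
      nr.toMetricSpace.toPseudoMetricSpace.toUniformSpace :=
    inferInstanceAs (CompleteSpace (Fin n → Fin n → ℂ))
  refine ⟨fun t => NormedSpace.exp (t • G), by simp, fun s t => ?_, fun t i j => ?_⟩
  · simp only [add_smul]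
    exact Matrix.exp_add_of_commute _ _ (((Commute.refl G).smul_left s).smul_right t)
  · have h := hasDerivAt_exp_smul_const' (𝕂 := ℝ) G t
    exact (hasDerivAt_pi.1 (hasDerivAt_pi.1 h i) j)

theorem semigroup_deriv {A : Type*} [NormedRing A] [NormedAlgebra ℝ A] [CompleteSpace A]
    (T : ℝ → A) (h0 : T 0 = 1) (hadd : ∀ s t : ℝ, 0 ≤ s → 0 ≤ t → T (s + t) = T s * T t)
    (hc : ContinuousOn T (Set.Ici 0)) :
    ∃ L : A, ∀ t, 0 ≤ t → HasDerivWithinAt T (L * T t) (Set.Ici 0) t := by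
  -- extended continuous function
  let S : ℝ → A := fun t => T (max t 0)
  have hS : Continuous S := by
    refine hc.comp_continuous (by fun_prop) fun t => ?_
    simp
  have hST : ∀ t, 0 ≤ t → S t = T t := fun t ht => by simp [S, max_eq_left ht]
  let I : ℝ → A := fun a => ∫ u in (0:ℝ)..a, S u
  have hI : ∀ t, HasDerivAt I (S t) t := fun t =>
    intervalIntegral.integral_hasDerivAt_right (hS.intervalIntegrable _ _)
      (hS.stronglyMeasurableAtFilter _ _) hS.continuousAt
  have hI0 : I 0 = 0 := by simp [I]
  -- find invertible
  obtain ⟨a, ha, hu⟩ : ∃ a : ℝ, 0 < a ∧ IsUnit (I a) := by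
    have h1 := (hI 0).tendsto_slope_zero_right
    simp only [zero_add, hI0, sub_zero, hST 0 le_rfl, h0] at h1
    have h2 := h1.eventually (Units.isOpen.mem_nhds (isUnit_one : IsUnit (1 : A)))
    obtain ⟨a, ha, ha'⟩ := (h2.and self_mem_nhdsWithin).exists
    refine ⟨a, ha', ?_⟩
    have ha0 : a ≠ 0 := ne_of_gt ha'
    have : IsUnit (a⁻¹ • I a) := ha
    have h3 : IsUnit (algebraMap ℝ A a * (a⁻¹ • I a)) := 
      ((IsUnit.mk0 a ha0).map (algebraMap ℝ A)).mul this
    rwa [← Algebra.smul_def, smul_smul, mul_inv_cancel₀ ha0, one_smul] at h3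
  obtain ⟨W, hW⟩ := hu
  have key : ∀ t, 0 ≤ t → I a * T t = I (t + a) - I t := by
    intro t ht
    have : I a * T t = ∫ u in (0:ℝ)..a, S u * T t := by
      exact ((((ContinuousLinearMap.mul ℝ A).flip (T t)).intervalIntegral_comp_comm
        (hS.intervalIntegrable 0 a))).symm
    rw [this]
    have h2 : ∫ u in (0:ℝ)..a, S u * T t = ∫ u in (0:ℝ)..a, S (u + t) := by
      refine intervalIntegral.integral_congr fun u hu => ?_
      rw [Set.uIcc_of_le ha.le] at hu
      show S u * T t = S (u + t)
      rw [hST u hu.1, hST (u + t) (add_nonneg hu.1 ht), hadd u t hu.1 ht]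
    rw [h2, intervalIntegral.integral_comp_add_right, zero_add, add_comm a t]
    exact (intervalIntegral.integral_interval_sub_left (hS.intervalIntegrable _ _)
      (hS.intervalIntegrable _ _)).symm
  refine ⟨↑W⁻¹ * (T a - 1), fun t ht => ?_⟩
  have hd : HasDerivAt (fun t => ↑W⁻¹ * (I (t + a) - I t)) (↑W⁻¹ * (S (t + a) - S t)) t := by
    refine HasDerivAt.const_mul _ (HasDerivAt.sub ?_ (hI t))
    simpa using (hI (t + a)).comp_add_const t a
  have heq : ∀ t ∈ Set.Ici (0:ℝ), T t = ↑W⁻¹ * (I (t + a) - I t) := by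
    intro t ht
    rw [← key t ht, ← hW, Units.inv_mul_cancel_left]
  have := (hd.hasDerivWithinAt (s := Set.Ici 0)).congr heq (heq t ht)
  rw [hST t ht, hST _ (add_nonneg ht ha.le), add_comm t a, hadd a t ha.le ht] at this
  have e : ↑W⁻¹ * (T a - 1) * T t = ↑W⁻¹ * (T a * T t - T t) := by noncomm_ring
  rw [e]
  exact this

open scoped MatrixOrder Matrix.Norms.L2Operator in
theorem psd_fac {d : Type*} [Fintype d] [DecidableEq d] {M : Matrix d d ℂ} (h : M.PosSemidef) :
    ∃ B : Matrix d d ℂ, M = Bᴴ * B :=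
  CStarAlgebra.nonneg_iff_eq_star_mul_self.mp h.nonneg

theorem unitary_group_exists {K : Type} [NormedAddCommGroup K] [InnerProductSpace ℂ K]
    [CompleteSpace K] {ι : Type} (v : ℝ → ι → K)
    (hst : ∀ s t u i j, inner ℂ (v (s + u) i) (v (t + u) j) = inner ℂ (v s i) (v t j))
    (hc : ∀ i, Continuous fun t => v t i) :
    ∃ V : ℝ → K →L[ℂ] K, (∀ t, V t ∈ unitary (K →L[ℂ] K)) ∧ V 0 = 1 ∧
      (∀ s t, V (s + t) = V s * V t) ∧ (∀ x, Continuous fun t => V t x) ∧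
      ∀ t s i, V t (v s i) = v (s + t) i := by
  let Φ : ℝ → ((ℝ × ι) →₀ ℂ) →ₗ[ℂ] K := fun u =>
    Finsupp.linearCombination ℂ (fun p : ℝ × ι => v (p.1 + u) p.2)
  have hΦ : ∀ u x, Φ u x = x.sum fun p c => c • v (p.1 + u) p.2 := fun u x =>
    Finsupp.linearCombination_apply _ _
  have hin : ∀ u w r x y, inner ℂ (Φ (u + r) x) (Φ (w + r) y) = inner ℂ (Φ u x) (Φ w y) := by
    intro u w r x y
    simp only [hΦ, Finsupp.sum, sum_inner, inner_sum, inner_smul_left, inner_smul_right]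
    refine Finset.sum_congr rfl fun p _ => ?_
    congr 1
    refine Finset.sum_congr rfl fun q _ => ?_
    rw [← add_assoc, ← add_assoc, hst]
  have hnorm : ∀ u x, ‖Φ u x‖ = ‖Φ 0 x‖ := by
    intro u x
    have := hin 0 0 u x x
    rw [zero_add, inner_self_eq_norm_sq_to_K, inner_self_eq_norm_sq_to_K] at this
    have h2 : ‖Φ u x‖ ^ 2 = ‖Φ 0 x‖ ^ 2 := by exact_mod_cast this
    exact (sq_eq_sq₀ (norm_nonneg _) (norm_nonneg _)).1 h2
  let sh : ℝ → ((ℝ × ι) →₀ ℂ) →ₗ[ℂ] ((ℝ × ι) →₀ ℂ) := fun u =>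
    Finsupp.lmapDomain ℂ ℂ (fun p : ℝ × ι => (p.1 + u, p.2))
  have hsh : ∀ u w x, Φ w (sh u x) = Φ (u + w) x := by
    intro u w x
    simp only [sh, Φ, Finsupp.lmapDomain_apply, Finsupp.linearCombination_mapDomain]
    congr 2
    funext p
    simp [add_assoc]
  let M : Submodule ℂ K := (LinearMap.range (Φ 0)).topologicalClosure
  have hMcl : IsClosed (M : Set K) := Submodule.isClosed_topologicalClosure _
  have : CompleteSpace M := hMcl.completeSpace_coe
  have hmem : ∀ u x, Φ u x ∈ M := by
    intro u x
    refine Submodule.le_topologicalClosure _ ⟨sh u x, ?_⟩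
    rw [hsh, add_zero]
  let e : ((ℝ × ι) →₀ ℂ) →ₗ[ℂ] M := (Φ 0).codRestrict M (hmem 0)
  have hed : DenseRange e := by
    intro y
    rw [mem_closure_iff_seq_limit]
    obtain ⟨y, hy⟩ := y
    have hy' : y ∈ closure (LinearMap.range (Φ 0) : Set K) := by
      rwa [← Submodule.topologicalClosure_coe]
    obtain ⟨f, hf, hlim⟩ := mem_closure_iff_seq_limit.1 hy'
    choose g hg using hf
    refine ⟨fun n => e (g n), fun n => ⟨_, rfl⟩, ?_⟩
    rw [tendsto_subtype_rng]
    simpa [e, hg] using hlim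
  let U : ℝ → M →L[ℂ] K := fun u => (Φ u).extendOfNorm e
  have hU : ∀ u x, U u (e x) = Φ u x := fun u x =>
    LinearMap.extendOfNorm_eq hed ⟨1, fun x => by rw [one_mul, hnorm]; rfl⟩ x
  let P : K →L[ℂ] M := M.orthogonalProjectionOnto
  have hPo : ∀ y, y - P y ∈ Mᗮ := fun y => M.sub_starProjection_mem_orthogonal y
  let V : ℝ → K →L[ℂ] K := fun u => (U u) ∘L P + (1 - M.subtypeL ∘L P)
  have hV : ∀ u y, V u y = U u (P y) + (y - P y) := fun u y => by simp [V]
  have hVM : ∀ u x, V u (Φ 0 x) = Φ u x := by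
    intro u x
    have h1 : P (Φ 0 x) = e x := by
      have := M.orthogonalProjectionOnto_mem_subspace_eq_self (e x)
      exact this
    rw [hV, h1, hU]
    simp [e]
  have hVM' : ∀ u w x, V u (Φ w x) = Φ (w + u) x := by
    intro u w x
    have := hVM u (sh w x)
    rwa [hsh, hsh, add_zero] at this
  have hVo : ∀ u, ∀ z ∈ Mᗮ, V u z = z := by
    intro u z hz
    have h1 : P z = 0 := M.orthogonalProjectionOnto_apply_of_mem_orthogonal hz
    rw [hV, h1]; simp
  have ext1 : ∀ {F : Type} [NormedAddCommGroup F] [NormedSpace ℂ F] (A B : K →L[ℂ] F),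
      (∀ x, A (Φ 0 x) = B (Φ 0 x)) → (∀ z ∈ Mᗮ, A z = B z) → A = B := by
    intro F _ _ A B h1 h2
    have h3 : ∀ y ∈ M, A y = B y := by
      intro y hy
      have hy' : y ∈ closure (LinearMap.range (Φ 0) : Set K) := by
        rwa [← Submodule.topologicalClosure_coe]
      refine closure_minimal (t := {y | A y = B y}) ?_ (isClosed_eq A.continuous B.continuous) hy'
      rintro _ ⟨x, rfl⟩
      exact h1 x
    ext y
    have hy : y = (P y : K) + (y - P y) := by abel
    rw [hy, map_add, map_add, h3 _ (P y).2, h2 _ (hPo y)]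
  have hin0 : ∀ u x z, z ∈ Mᗮ → inner ℂ (Φ u x) z = 0 := fun u x z hz =>
    (Submodule.mem_orthogonal M z).1 hz _ (hmem u x)
  have hin0' : ∀ u x z, z ∈ Mᗮ → inner ℂ z (Φ u x) = 0 := fun u x z hz =>
    (Submodule.mem_orthogonal' M z).1 hz _ (hmem u x)
  have vext : ∀ a b : K, (∀ x, inner ℂ a (Φ 0 x) = inner ℂ b (Φ 0 x)) →
      (∀ z ∈ Mᗮ, inner ℂ a z = inner ℂ b z) → a = b := by
    intro a b h1 h2
    have := ext1 (innerSL ℂ a) (innerSL ℂ b) (by simpa using h1) (by simpa using h2)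
    refine ext_inner_right ℂ fun y => ?_
    simpa using congrArg (fun f => f y) this
  have hadd : ∀ s t, V (s + t) = V s * V t := by
    intro s t
    refine ext1 _ _ (fun x => ?_) (fun z hz => ?_)
    · rw [mul_apply_eq_comp, hVM, hVM, hVM', add_comm]
    · rw [mul_apply_eq_comp, hVo _ z hz, hVo _ z hz, hVo _ z hz]
  have hzero : V 0 = 1 := by
    refine ext1 _ _ (fun x => ?_) (fun z hz => ?_)
    · rw [hVM]; rfl
    · rw [hVo _ z hz]; rfl
  have hadj : ∀ u, star (V u) = V (-u) := by
    intro u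
    rw [ContinuousLinearMap.star_eq_adjoint]
    refine ext1 _ _ (fun x => ?_) (fun z hz => ?_)
    · refine vext _ _ (fun y => ?_) (fun w hw => ?_)
      · rw [ContinuousLinearMap.adjoint_inner_left, hVM, hVM, ← hin (-u) 0 u]
        simp
      · rw [ContinuousLinearMap.adjoint_inner_left, hVM, hVo _ w hw, hin0 _ _ _ hw, hin0 _ _ _ hw]
    · refine vext _ _ (fun y => ?_) (fun w hw => ?_)
      · rw [ContinuousLinearMap.adjoint_inner_left, hVM, hVo _ z hz, hin0' _ _ _ hz,
          hin0' _ _ _ hz]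
      · rw [ContinuousLinearMap.adjoint_inner_left, hVo _ w hw, hVo _ z hz]
  have huni : ∀ t, V t ∈ unitary (K →L[ℂ] K) := by
    intro t
    rw [Unitary.mem_iff, hadj, ← hadd, ← hadd]
    simp [hzero]
  have hiso : ∀ t y, ‖V t y‖ = ‖y‖ := by
    intro t y
    exact ContinuousLinearMap.norm_map_of_mem_unitary (huni t) y
  have hcΦ : ∀ x, Continuous fun t => Φ t x := by
    intro x
    simp only [hΦ, Finsupp.sum]
    refine continuous_finsetSum _ fun p _ => ?_
    exact ((hc p.2).comp (continuous_const.add continuous_id)).const_smul _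
  have hcM : ∀ y ∈ M, Continuous fun t => V t y := by
    intro y hy
    have hy' : y ∈ closure (LinearMap.range (Φ 0) : Set K) := by
      rwa [← Submodule.topologicalClosure_coe]
    refine continuous_of_uniform_approx_of_continuous fun W hW => ?_
    obtain ⟨ε, hε, hεW⟩ := Metric.mem_uniformity_dist.1 hW
    obtain ⟨_, ⟨x, rfl⟩, hx⟩ := Metric.mem_closure_iff.1 hy' ε hε
    refine ⟨fun t => V t (Φ 0 x), ?_, fun t => hεW ?_⟩
    · simp only [hVM]; exact hcΦ x
    · rw [dist_eq_norm, ← map_sub, hiso, ← dist_eq_norm]; exact hx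
  refine ⟨V, huni, hzero, hadd, fun y => ?_, fun t s i => ?_⟩
  · have hy : y = (P y : K) + (y - P y) := by abel
    have : (fun t => V t y) = fun t => V t (P y : K) + (y - P y) := by
      funext t
      conv_lhs => rw [hy]
      rw [map_add, hVo _ _ (hPo y)]
    rw [this]
    exact (hcM _ (P y).2).add continuous_const
  · have := hVM' t s (Finsupp.single (0, i) 1)
    simpa [Φ] using this

abbrev Mat (n : ℕ) := Matrix (Fin n) (Fin n) ℂ

/-- block lemma -/
theorem cp_conj {n : ℕ} (W : Mat n) : IsCompletelyPositive (fun A : Mat n => Wᴴ * A * W) := by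
  intro k A hA
  have h := hA.conjTranspose_mul_mul_same (Matrix.kroneckerMap (· * ·) (1 : Matrix (Fin k) (Fin k) ℂ) W)
  convert h using 1
  ext ⟨p, j⟩ ⟨q, l⟩
  simp [Matrix.mul_apply, Fintype.sum_prod_type, Matrix.one_apply, ite_mul, apply_ite]

theorem cp_sum {n : ℕ} {ι : Type*} (S : Finset ι) (Φ : ι → Mat n → Mat n)
    (h : ∀ i ∈ S, IsCompletelyPositive (Φ i)) :
    IsCompletelyPositive (fun A => ∑ i ∈ S, Φ i A) := by
  intro k A hA
  have := Matrix.posSemidef_sum S (fun i hi => h i hi k A hA)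
  convert this using 1
  ext p q
  simp [Matrix.sum_apply]

theorem cp_comp {n : ℕ} {Φ Ψ : Mat n → Mat n} (h1 : IsCompletelyPositive Φ)
    (h2 : IsCompletelyPositive Ψ) : IsCompletelyPositive (fun A => Φ (Ψ A)) := by
  intro k A hA
  exact h1 k (fun p q => Ψ (A p q)) (h2 k A hA)

def choi {n : ℕ} (Φ : Mat n → Mat n) : Matrix (Fin n × Fin n) (Fin n × Fin n) ℂ :=
  Matrix.of fun p q => Φ (Matrix.single p.1 q.1 1) p.2 q.2

def om (n : ℕ) : Fin n × Fin n → ℂ := fun p => if p.1 = p.2 then 1 else 0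

theorem choi_id (n : ℕ) : choi (fun A : Mat n => A) = Matrix.vecMulVec (om n) (star (om n)) := by
  ext ⟨a, j⟩ ⟨b, k⟩
  simp only [choi, om, Matrix.vecMulVec_apply, Matrix.of_apply, Matrix.single_apply, Pi.star_apply]
  by_cases h1 : a = j <;> by_cases h2 : b = k <;> simp [h1, h2]

theorem choi_of_cp {n : ℕ} {Φ : Mat n → Mat n} (h : IsCompletelyPositive Φ) :
    (choi Φ).PosSemidef := by
  refine h n (fun p q => Matrix.single p q 1) ?_
  have := Matrix.posSemidef_vecMulVec_self_star (om n)
  rw [← choi_id] at this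
  exact this

theorem apply_eq_choi {n : ℕ} (Φ : Mat n →ₗ[ℂ] Mat n) (A : Mat n) (j k : Fin n) :
    Φ A j k = ∑ a, ∑ b, A a b * choi Φ (a, j) (b, k) := by
  conv_lhs => rw [Matrix.matrix_eq_sum_single A]
  simp only [map_sum, Matrix.sum_apply]
  refine Finset.sum_congr rfl fun a _ => Finset.sum_congr rfl fun b _ => ?_
  have : Matrix.single a b (A a b) = A a b • (Matrix.single a b 1 : Mat n) := by simp
  rw [this, map_smul]
  simp [choi]

theorem cp_of_choi {n : ℕ} (Φ : Mat n →ₗ[ℂ] Mat n) (h : (choi Φ).PosSemidef) :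
    IsCompletelyPositive (fun A => Φ A) := by
  obtain ⟨B, hB⟩ := psd_fac h
  have := cp_sum Finset.univ (fun r A => (Matrix.of fun a j => B r (a, j))ᴴ * A *
    (Matrix.of fun a j => B r (a, j))) (fun r _ => cp_conj _)
  convert this using 2 with A
  ext j k
  rw [apply_eq_choi, hB]
  simp only [Matrix.mul_apply, Matrix.sum_apply, Matrix.conjTranspose_apply, Matrix.of_apply,
    Finset.mul_sum, Finset.sum_mul]
  conv_rhs => rw [Finset.sum_comm]
  rw [Finset.sum_comm]
  refine Finset.sum_congr rfl fun a _ => ?_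
  conv_rhs => rw [Finset.sum_comm]
  refine Finset.sum_congr rfl fun b _ => ?_
  refine Finset.sum_congr rfl fun r _ => ?_
  ring

theorem one_of_cp {n : ℕ} {Φ : Mat n → Mat n} (h : IsCompletelyPositive Φ) :
    (Φ 1).PosSemidef := by
  have := h 1 (fun _ _ => 1) ?_
  · have h2 := this.submatrix (fun i : Fin n => ((0 : Fin 1), i))
    exact h2
  · have := (Matrix.PosSemidef.one (n := Fin n) (R := ℂ)).submatrix (fun p : Fin 1 × Fin n => p.2)
    exact this

/-- entrywise derivative -/
def MD {d e : Type*} (X : ℝ → Matrix d e ℂ) (X' : Matrix d e ℂ) (t : ℝ) : Prop :=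
  ∀ i j, HasDerivWithinAt (fun s => X s i j) (X' i j) (Set.Ici 0) t

theorem MD.mul {d e f : Type*} [Fintype e] {X : ℝ → Matrix d e ℂ} {X' : Matrix d e ℂ} {t : ℝ}
    {Y : ℝ → Matrix e f ℂ} {Y' : Matrix e f ℂ} (hX : MD X X' t) (hY : MD Y Y' t) :
    MD (fun s => X s * Y s) (X' * Y t + X t * Y') t := by
  intro i j
  simp only [Matrix.mul_apply, Matrix.add_apply, ← Finset.sum_add_distrib]
  exact HasDerivWithinAt.fun_sum fun k _ => (hX i k).mul (hY k j)

theorem MD.cstar {d e : Type*} {X : ℝ → Matrix d e ℂ} {X' : Matrix d e ℂ} {t : ℝ}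
    (hX : MD X X' t) : MD (fun s => (X s)ᴴ) X'ᴴ t := by
  intro i j
  exact (hX j i).star

theorem MD.unique {d e : Type*} {X : ℝ → Matrix d e ℂ} {X' X'' : Matrix d e ℂ} {t : ℝ}
    (ht : 0 ≤ t) (h1 : MD X X' t) (h2 : MD X X'' t) : X' = X'' := by
  ext i j
  exact (uniqueDiffOn_Ici (0:ℝ) t ht).eq_deriv _ (h1 i j) (h2 i j)

theorem MD.congr {d e : Type*} {X Y : ℝ → Matrix d e ℂ} {X' : Matrix d e ℂ} {t : ℝ}
    (ht : 0 ≤ t) (h1 : MD X X' t) (h : ∀ s, 0 ≤ s → Y s = X s) : MD Y X' t := by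
  intro i j
  exact (h1 i j).congr (fun s hs => by rw [h s hs]) (by rw [h t ht])

theorem MD.quad {d : Type*} [Fintype d] {X : ℝ → Matrix d d ℂ} {X' : Matrix d d ℂ} {t : ℝ}
    (hX : MD X X' t) (v : d → ℂ) :
    HasDerivWithinAt (fun s => star v ⬝ᵥ (X s *ᵥ v)) (star v ⬝ᵥ (X' *ᵥ v)) (Set.Ici 0) t := by
  simp only [dotProduct, Matrix.mulVec]
  exact HasDerivWithinAt.fun_sum fun i _ => HasDerivWithinAt.const_mul _ <|
    HasDerivWithinAt.fun_sum fun j _ => (hX i j).mul_const _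

theorem quad_herm {d : Type*} [Fintype d] {M : Matrix d d ℂ} (h : M.IsHermitian) (v : d → ℂ)
    (hr : 0 ≤ (star v ⬝ᵥ (M *ᵥ v)).re) : 0 ≤ star v ⬝ᵥ (M *ᵥ v) := by
  rw [Complex.le_def]
  refine ⟨hr, ?_⟩
  have := h.im_star_dotProduct_mulVec_self v
  exact this.symm

theorem hre {f : ℝ → ℂ} {f' : ℂ} {s : Set ℝ} {t : ℝ} (h : HasDerivWithinAt f f' s t) :
    HasDerivWithinAt (fun x => (f x).re) f'.re s t :=
  Complex.reCLM.hasFDerivAt.comp_hasDerivWithinAt t h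

theorem mono_psd {d : Type*} [Fintype d] (X X' : ℝ → Matrix d d ℂ)
    (hH : ∀ t, 0 ≤ t → (X t).IsHermitian) (hd : ∀ t, 0 ≤ t → MD X (X' t) t)
    (hp : ∀ t, 0 ≤ t → (X' t).PosSemidef) {s t : ℝ} (hs : 0 ≤ s) (hst : s ≤ t) :
    (X t - X s).PosSemidef := by
  have hH' := (hH t (hs.trans hst)).sub (hH s hs)
  refine Matrix.PosSemidef.of_dotProduct_mulVec_nonneg hH' fun v => quad_herm hH' v ?_
  have hq : ∀ t : ℝ, (0 : ℝ) ≤ t → _ := fun t ht => hre ((hd t ht).quad v)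
  have hm : MonotoneOn (fun t => (star v ⬝ᵥ (X t *ᵥ v)).re) (Set.Ici 0) := by
    refine monotoneOn_of_deriv_nonneg (convex_Ici 0) (fun t ht => (hq t ht).continuousWithinAt)
      (fun t ht => ?_) (fun t ht => ?_)
    · rw [interior_Ici] at ht
      exact ((hq t (le_of_lt ht)).differentiableWithinAt).mono interior_subset
    · rw [interior_Ici] at ht
      rw [((hq t (le_of_lt ht)).hasDerivAt (Ici_mem_nhds ht)).deriv]
      exact (Complex.le_def.1 ((hp t (le_of_lt ht)).dotProduct_mulVec_nonneg v)).1
  have := hm hs (hs.trans hst) hst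
  simp only [Matrix.sub_mulVec, dotProduct_sub, Complex.sub_re]
  linarith

theorem pcp {d : Type*} [Fintype d] [DecidableEq d] (C : Matrix d d ℂ) (hH : C.IsHermitian)
    (w : d → ℂ) (hwr : star w = w) (c : ℂ) (hcr : star c = c) (hcw : c * (w ⬝ᵥ w) = 1 ∨ w = 0)
    (hp : ∀ v, w ⬝ᵥ v = 0 → 0 ≤ star v ⬝ᵥ (C *ᵥ v)) :
    ∃ g : d → ℂ, (C - Matrix.vecMulVec w g - Matrix.vecMulVec (star g) w).PosSemidef := by
  obtain ⟨u, hu⟩ : ∃ u, u = C *ᵥ w := ⟨_, rfl⟩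
  have huC : w ᵥ* C = star u := by
    rw [hu, Matrix.star_mulVec, hwr, hH.eq]
  obtain ⟨κ, hκ⟩ : ∃ κ, κ = w ⬝ᵥ u := ⟨_, rfl⟩
  have hκr : star κ = κ := by
    rw [hκ, ← Matrix.star_dotProduct_star, hwr, ← huC, ← Matrix.dotProduct_mulVec, ← hu]
  have h2 : star u ⬝ᵥ w = κ := by rw [hκ, hu, Matrix.dotProduct_mulVec, ← hu, huC]
  obtain ⟨P, hP⟩ : ∃ P : Matrix d d ℂ, P = 1 - c • Matrix.vecMulVec w w := ⟨_, rfl⟩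
  have hPH : Pᴴ = P := by
    simp [hP, Matrix.conjTranspose_vecMulVec, hwr]
    exact congrArg (· • Matrix.vecMulVec w w) hcr
  obtain ⟨g, hg⟩ : ∃ g : d → ℂ, g = fun p => c * star (u p) - c ^ 2 / 2 * κ * w p := ⟨_, rfl⟩
  refine ⟨g, ?_⟩
  have e2 : C - Matrix.vecMulVec w g - Matrix.vecMulVec (star g) w = Pᴴ * C * P := by
    rw [hPH, hP]
    simp only [sub_mul, mul_sub, one_mul, mul_one, Matrix.smul_mul, Matrix.mul_smul,
      Matrix.vecMulVec_mul, Matrix.mul_vecMulVec, huC, ← hu, Matrix.vecMulVec_mulVec,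
      Matrix.smul_mulVec, h2]
    ext p q
    have h3 : star (w p) = w p := congrFun hwr p
    have h4 : star (2 : ℂ) = 2 := by simp
    simp only [Matrix.sub_apply, Matrix.smul_apply, Matrix.vecMulVec_apply, hg, Pi.star_apply,
      star_sub, star_mul', star_star, star_pow, star_div₀, hcr, hκr, smul_eq_mul, Pi.smul_apply, h3,
      h4, MulOpposite.smul_eq_mul_unop, MulOpposite.unop_op]
    ring
  have hz : ∀ v, w ⬝ᵥ (P *ᵥ v) = 0 := by
    intro v
    rcases hcw with h | h
    · have h5 : w ⬝ᵥ (P *ᵥ v) = w ⬝ᵥ v - c * (w ⬝ᵥ w) * (w ⬝ᵥ v) := by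
        simp [hP, Matrix.sub_mulVec, Matrix.smul_mulVec, Matrix.vecMulVec_mulVec, dotProduct_sub]
        ring
      rw [h5, h]; ring
    · simp [h]
  have hher : (Pᴴ * C * P).IsHermitian := Matrix.isHermitian_conjTranspose_mul_mul P hH
  rw [e2]
  refine Matrix.PosSemidef.of_dotProduct_mulVec_nonneg hher fun v => ?_
  have := hp (P *ᵥ v) (hz v)
  rw [Matrix.star_mulVec, ← Matrix.dotProduct_mulVec, Matrix.mulVec_mulVec, Matrix.mulVec_mulVec] at this
  exact this

theorem om_real (n : ℕ) : star (om n) = om n := by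
  ext p; simp only [om, Pi.star_apply]; split_ifs <;> simp

theorem lindblad {n : ℕ} (L : Mat n →ₗ[ℂ] Mat n) (hH : (choi L).IsHermitian)
    (hp : ∀ v, om n ⬝ᵥ v = 0 → 0 ≤ star v ⬝ᵥ (choi L *ᵥ v)) :
    ∃ (G : Mat n) (Ψ : Mat n →ₗ[ℂ] Mat n), (∀ A, L A = Ψ A + A * G + Gᴴ * A) ∧
      IsCompletelyPositive (fun A => Ψ A) := by
  obtain ⟨g, hg⟩ := pcp (choi L) hH (om n) (om_real n) ((n : ℂ)⁻¹) (by simp) (by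
    rcases Nat.eq_zero_or_pos n with h | h
    · subst h; right; ext p; exact p.1.elim0
    · left
      have hn : (n : ℂ) ≠ 0 := by exact_mod_cast h.ne'
      have hww : om n ⬝ᵥ om n = n := by
        simp [dotProduct, om, Fintype.sum_prod_type]
      rw [hww]; field_simp) hp
  obtain ⟨G, hG⟩ : ∃ G : Mat n, G = Matrix.of fun b k => g (b, k) := ⟨_, rfl⟩
  have hG' : ∀ b k, g (b, k) = G b k := fun b k => by rw [hG]; rfl
  obtain ⟨Ψ, hΨ⟩ : ∃ Ψ : Mat n →ₗ[ℂ] Mat n, ∀ A, Ψ A = L A - A * G - Gᴴ * A :=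
    ⟨L - LinearMap.mulRight ℂ G - LinearMap.mulLeft ℂ Gᴴ, fun A => rfl⟩
  refine ⟨G, Ψ, fun A => by rw [hΨ]; abel, cp_of_choi Ψ ?_⟩
  convert hg using 1
  ext ⟨a, j⟩ ⟨b, k⟩
  simp only [choi, om, Matrix.of_apply, Matrix.sub_apply, hΨ, Matrix.vecMulVec_apply, Pi.star_apply,
    hG']
  congr 1
  · congr 1
    by_cases h : a = j
    · subst h; simp
    · simp [h, Ne.symm h]
  · by_cases h : b = k
    · subst h; simp
    · simp [h, Ne.symm h]

theorem semigroup_deriv_clm {E : Type*} [NormedAddCommGroup E] [NormedSpace ℂ E] [CompleteSpace E]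
    (T : ℝ → (E →L[ℂ] E)) (hT0 : T 0 = ContinuousLinearMap.id ℂ E)
    (hTadd : ∀ s t : ℝ, 0 ≤ s → 0 ≤ t → T (s + t) = (T s).comp (T t))
    (hTcont : ContinuousOn T (Set.Ici (0 : ℝ))) :
    ∃ L : E →L[ℂ] E, ∀ t, 0 ≤ t → ∀ A,
      HasDerivWithinAt (fun s => T s A) (L (T t A)) (Set.Ici 0) t := by
  obtain ⟨L, hL⟩ := semigroup_deriv T hT0 hTadd hTcont
  refine ⟨L, fun t ht A => ?_⟩
  have h1 := hL t ht
  exact ((ContinuousLinearMap.apply ℂ E A).restrictScalars ℝ).hasFDerivAt.comp_hasDerivWithinAt t h1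

theorem gen_exists {n : ℕ}
    (T : ℝ → (Matrix (Fin n) (Fin n) ℂ →L[ℂ] Matrix (Fin n) (Fin n) ℂ))
    (hT0 : T 0 = ContinuousLinearMap.id ℂ (Matrix (Fin n) (Fin n) ℂ))
    (hTadd : ∀ s t : ℝ, 0 ≤ s → 0 ≤ t → T (s + t) = (T s).comp (T t))
    (hTcont : ContinuousOn T (Set.Ici (0 : ℝ))) :
    ∃ L : Mat n →ₗ[ℂ] Mat n, ∀ t, 0 ≤ t → ∀ A, MD (fun s => T s A) (L (T t A)) t := by
  obtain ⟨L, hL⟩ := semigroup_deriv_clm (E := Mat n) T hT0 hTadd hTcont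
  refine ⟨L.toLinearMap, fun t ht A i j => ?_⟩
  have h2 := hL t ht A
  exact (hasDerivWithinAt_pi.1 (hasDerivWithinAt_pi.1 h2 i)) j

theorem gks {n : ℕ} (T : ℝ → Mat n → Mat n) (L : Mat n →ₗ[ℂ] Mat n)
    (hT0 : ∀ A, T 0 A = A) (hL : ∀ t, 0 ≤ t → ∀ A, MD (fun s => T s A) (L (T t A)) t)
    (hTcp : ∀ t : ℝ, 0 ≤ t → IsCompletelyPositive (T t))
    (hTunital : ∀ t : ℝ, 0 ≤ t → T t 1 = 1) :
    ∃ (G : Mat n) (Ψ : Mat n →ₗ[ℂ] Mat n), (∀ A, L A = Ψ A + A * G + Gᴴ * A) ∧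
      IsCompletelyPositive (fun A => Ψ A) ∧ (-G - Gᴴ).PosSemidef := by
  have hc : MD (fun s => choi (T s)) (choi L) 0 := by
    intro p q
    have := hL 0 le_rfl (Matrix.single p.1 q.1 1) p.2 q.2
    rw [hT0] at this
    exact this
  have hH : (choi L).IsHermitian := by
    refine MD.unique le_rfl hc.cstar (hc.congr le_rfl fun s hs => ?_)
    exact (choi_of_cp (hTcp s hs)).1
  obtain ⟨G, Ψ, h1, h2⟩ := lindblad L hH (fun v hv => by
    refine quad_herm hH v ?_
    have hd := hre (hc.quad v)
    have h0 : (star v ⬝ᵥ (choi (T 0) *ᵥ v)) = 0 := by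
      have : choi (T 0) = Matrix.vecMulVec (om n) (om n) := by
        have := choi_id n
        rw [om_real] at this
        rw [← this]
        congr 1
        funext A; exact hT0 A
      rw [this, Matrix.vecMulVec_mulVec, hv]
      simp
    have hd2 := (hasDerivWithinAt_iff_tendsto_slope.1 hd)
    rw [Set.Ici_sdiff_left] at hd2
    refine ge_of_tendsto hd2 ?_
    filter_upwards [self_mem_nhdsWithin] with s hs
    have hs0 : 0 ≤ s := le_of_lt hs
    rw [slope_def_field, h0]
    have := (Complex.le_def.1 ((choi_of_cp (hTcp s hs0)).dotProduct_mulVec_nonneg v)).1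
    simp only [Complex.zero_re, sub_zero] at this ⊢
    exact div_nonneg this hs0)
  refine ⟨G, Ψ, h1, h2, ?_⟩
  have h3 : L 1 = 0 := by
    have h4 := hL 0 le_rfl 1
    rw [hT0] at h4
    refine MD.unique le_rfl h4 (MD.congr (X := fun _ => 1) le_rfl (fun i j => ?_) fun s hs => hTunital s hs)
    exact hasDerivWithinAt_const _ _ _
  have h5 := h1 1
  rw [h3, one_mul, mul_one] at h5
  have h6 : -G - Gᴴ = Ψ 1 := by
    have : Ψ 1 = Ψ 1 + G + Gᴴ - G - Gᴴ := by abel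
    rw [this, ← h5]; simp
  rw [h6]
  exact one_of_cp h2

theorem exp2 {n : ℕ} (G : Mat n) : ∃ F : ℝ → Mat n, F 0 = 1 ∧ (∀ s t, F (s + t) = F s * F t) ∧
    (∀ t, F t * G = G * F t) ∧ (∀ t, MD (fun s => F (-s)) (-(G * F (-t))) t) ∧
    (∀ i j, Continuous fun t => F t i j) := by
  obtain ⟨F, h0, hadd, hd⟩ := matrix_exp_exists G
  refine ⟨F, h0, hadd, fun t => ?_, fun t i j => ?_, fun i j => ?_⟩
  · have h1 : MD F G 0 := by
      intro i j
      have := (hd 0 i j).hasDerivWithinAt (s := Set.Ici 0)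
      rwa [h0, mul_one] at this
    have hcst : MD (fun _ : ℝ => F t) 0 0 := fun i j => hasDerivWithinAt_const _ _ _
    have h2 := h1.mul hcst
    have h3 := hcst.mul h1
    simp only [zero_mul, mul_zero, add_zero, zero_add] at h2 h3
    refine MD.unique le_rfl h3 (h2.congr le_rfl fun s _ => ?_)
    rw [← hadd, ← hadd, add_comm]
  · have := HasDerivAt.scomp t (hd (-t) i j) (hasDerivAt_neg t)
    have := this.hasDerivWithinAt (s := Set.Ici 0)
    simp only [neg_smul, one_smul] at this
    exact this
  · exact continuous_iff_continuousAt.2 fun t => (hd t i j).continuousAt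

theorem X_mono {n : ℕ} (T : ℝ → Mat n →ₗ[ℂ] Mat n) (L Ψ : Mat n →ₗ[ℂ] Mat n) (G : Mat n)
    (hL : ∀ t, 0 ≤ t → ∀ A, MD (fun s => T s A) (L (T t A)) t)
    (hTcp : ∀ t : ℝ, 0 ≤ t → IsCompletelyPositive (T t))
    (hG : ∀ A, L A = Ψ A + A * G + Gᴴ * A) (hΨ : IsCompletelyPositive (fun A => Ψ A))
    (F : ℝ → Mat n) (hF : ∀ t, MD (fun s => F (-s)) (-(G * F (-t))) t)
    {s t : ℝ} (hs : 0 ≤ s) (hst : s ≤ t) :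
    (choi (fun A => (F (-t))ᴴ * T t A * F (-t)) - choi (fun A => (F (-s))ᴴ * T s A * F (-s))).PosSemidef := by
  refine mono_psd (fun t => choi (fun A => (F (-t))ᴴ * T t A * F (-t)))
    (fun t => choi (fun A => (F (-t))ᴴ * Ψ (T t A) * F (-t))) (fun t ht => ?_) (fun t ht p q => ?_)
    (fun t ht => ?_) hs hst
  · exact (choi_of_cp (cp_comp (cp_conj (F (-t))) (hTcp t ht))).1
  · have h := (((hF t).cstar.mul (hL t ht (Matrix.single p.1 q.1 1))).mul (hF t)) p.2 q.2
    refine h.congr_deriv ?_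
    simp only [choi, Matrix.of_apply]
    refine congrFun (congrFun ?_ p.2) q.2
    generalize F (-t) = W
    rw [hG, Matrix.conjTranspose_neg, Matrix.conjTranspose_mul]
    simp only [mul_add, add_mul, neg_mul, mul_neg, mul_assoc]
    abel
  · exact choi_of_cp (cp_comp (cp_conj (F (-t))) (cp_comp hΨ (hTcp t ht)))

theorem Y_mono {n : ℕ} (G : Mat n) (hG : (-G - Gᴴ).PosSemidef)
    (F : ℝ → Mat n) (hF : ∀ t, MD (fun s => F (-s)) (-(G * F (-t))) t)
    (hFG : ∀ t, F t * G = G * F t)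
    {s t : ℝ} (hs : 0 ≤ s) (hst : s ≤ t) :
    (F (-t) * (F (-t))ᴴ - F (-s) * (F (-s))ᴴ).PosSemidef := by
  refine mono_psd (fun t => F (-t) * (F (-t))ᴴ)
    (fun t => F (-t) * (-G - Gᴴ) * (F (-t))ᴴ) (fun t ht => ?_) (fun t ht p q => ?_)
    (fun t ht => ?_) hs hst
  · exact Matrix.isHermitian_mul_conjTranspose_self _
  · have h := ((hF t).mul (hF t).cstar) p q
    refine h.congr_deriv ?_
    refine congrFun (congrFun ?_ p) q
    have h2 := congrArg Matrix.conjTranspose (hFG (-t))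
    simp only [Matrix.conjTranspose_mul] at h2
    rw [Matrix.conjTranspose_neg, Matrix.conjTranspose_mul, ← hFG, ← h2]
    noncomm_ring
  · exact hG.mul_mul_conjTranspose_same _

theorem sum_choi {n : ℕ} (Φ : Mat n →ₗ[ℂ] Mat n) (Φ' : Mat n → Mat n) (h : ∀ A, Φ A = Φ' A)
    (A : Mat n) (j k : Fin n) : ∑ a, ∑ b, A a b * choi Φ' (a, j) (b, k) = Φ' A j k := by
  rw [← h, apply_eq_choi]
  have : (Φ : Mat n → Mat n) = Φ' := funext h
  rw [this]

theorem kernel_pre {n : ℕ} (T : ℝ → Mat n →ₗ[ℂ] Mat n) (F : ℝ → Mat n) (hF0 : F 0 = 1)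
    (hT0 : ∀ A, T 0 A = A)
    (hX : ∀ s t : ℝ, 0 ≤ s → s ≤ t → (choi (fun A => (F (-t))ᴴ * T t A * F (-t)) -
      choi (fun A => (F (-s))ᴴ * T s A * F (-s))).PosSemidef)
    (hY : ∀ s t : ℝ, 0 ≤ s → s ≤ t → (F (-t) * (F (-t))ᴴ - F (-s) * (F (-s))ᴴ).PosSemidef) :
    ∃ R : Matrix (ℝ × (Fin n × Fin n)) (ℝ × (Fin n × Fin n)) ℂ, R.PosSemidef ∧
      (∀ s t A j k, ∑ a, ∑ b, A a b * R (s, a, j) (t, b, k) =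
        ((F (-(max (min s t) 0)))ᴴ * T (max (min s t) 0) A * F (-(max (min s t) 0)) +
          (A.trace * (n : ℂ)⁻¹) • (F (-(max (min (-s) (-t)) 0)) * (F (-(max (min (-s) (-t)) 0)))ᴴ - 1)) j k) ∧
      ∀ p q, R (0, p) (0, q) = om n p * om n q := by
  obtain ⟨Qp, hQp⟩ : ∃ Qp : ℝ → Matrix (Fin n × Fin n) (Fin n × Fin n) ℂ, Qp = fun t =>
    choi (fun A => (F (-(max t 0)))ᴴ * T (max t 0) A * F (-(max t 0))) -
      choi (fun A => (F (-0))ᴴ * T 0 A * F (-0)) := ⟨_, rfl⟩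
  obtain ⟨Y, hYd⟩ : ∃ Y : ℝ → Mat n, Y = fun t => F (-(max t 0)) * (F (-(max t 0)))ᴴ -
    F (-0) * (F (-0))ᴴ := ⟨_, rfl⟩
  obtain ⟨Qm, hQm⟩ : ∃ Qm : ℝ → Matrix (Fin n × Fin n) (Fin n × Fin n) ℂ, Qm = fun t =>
    Matrix.kroneckerMap (· * ·) ((n : ℂ)⁻¹ • (1 : Mat n)) (Y t) := ⟨_, rfl⟩
  have hone : ((n : ℂ)⁻¹ • (1 : Mat n)).PosSemidef := by
    refine Matrix.PosSemidef.one.smul ?_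
    rw [inv_nonneg]
    exact_mod_cast Nat.zero_le n
  have k1 := min_kernel Qp (fun t => by rw [hQp]; exact hX 0 _ le_rfl (le_max_right _ _))
    (fun s t hst => by
      have := hX (max s 0) (max t 0) (le_max_right _ _) (max_le_max_right _ hst)
      rw [hQp]
      simpa using this)
  have k2 := min_kernel Qm (fun t => by
      rw [hQm, hYd]
      exact hone.kronecker (hY 0 _ le_rfl (le_max_right _ _)))
    (fun s t hst => by
      have := hone.kronecker (hY (max s 0) (max t 0) (le_max_right _ _) (max_le_max_right _ hst))
      have h2 : Qm t - Qm s = Matrix.kroneckerMap (· * ·) ((n : ℂ)⁻¹ • (1 : Mat n))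
          (F (-(max t 0)) * (F (-(max t 0)))ᴴ - F (-(max s 0)) * (F (-(max s 0)))ᴴ) := by
        rw [hQm, hYd]
        ext p q
        simp only [Matrix.sub_apply, Matrix.kroneckerMap_apply]
        ring
      rw [h2]
      exact this)
  have k3 := (Matrix.posSemidef_vecMulVec_self_star (om n)).submatrix
    (Prod.snd : ℝ × (Fin n × Fin n) → _)
  refine ⟨_, (k3.add k1).add (k2.submatrix (fun p => (-p.1, p.2))), ?_, ?_⟩
  · intro s t A j k
    simp only [Matrix.add_apply, Matrix.submatrix_apply, Matrix.of_apply, mul_add,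
      Finset.sum_add_distrib]
    have e1 : ∑ a, ∑ b, A a b * Matrix.vecMulVec (om n) (star (om n)) (a, j) (b, k) = A j k := by
      simp [om_real, Matrix.vecMulVec_apply, om]
    have e2 : ∑ a, ∑ b, A a b * Qp (min s t) (a, j) (b, k) =
        ((F (-(max (min s t) 0)))ᴴ * T (max (min s t) 0) A * F (-(max (min s t) 0))) j k - A j k := by
      obtain ⟨m, hm⟩ : ∃ m, m = max (min s t) 0 := ⟨_, rfl⟩
      rw [← hm]
      have h := sum_choi (LinearMap.mulLeft ℂ (F (-m))ᴴ ∘ₗ LinearMap.mulRight ℂ (F (-m)) ∘ₗ T m)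
        (fun A => (F (-m))ᴴ * T m A * F (-m)) (fun A => (mul_assoc _ _ _).symm) A j k
      have h2 := sum_choi LinearMap.id (fun A => (F (-0))ᴴ * T 0 A * F (-0))
        (fun A => by simp [hF0, hT0]) A j k
      rw [hQp, ← h]
      have h3 : A j k = ((F (-0))ᴴ * T 0 A * F (-0)) j k := by simp [hF0, hT0]
      rw [h3, ← h2]
      simp only [Matrix.sub_apply, mul_sub, Finset.sum_sub_distrib, ← hm]
    have e3 : ∑ a, ∑ b, A a b * Qm (min (-s) (-t)) (a, j) (b, k) =
        (A.trace * (n : ℂ)⁻¹) • Y (min (-s) (-t)) j k := by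
      rw [hQm]
      simp [Matrix.kroneckerMap_apply, Matrix.one_apply, Matrix.trace, Finset.sum_mul, mul_assoc]
    rw [e1, e2, e3, hYd]
    simp [hF0]
  · intro p q
    have a1 : Qp 0 = 0 := by rw [hQp]; simp
    have a2 : Qm 0 = 0 := by rw [hQm, hYd]; simp
    simp [om_real, Matrix.vecMulVec_apply, a1, a2]

theorem E_stat {n : ℕ} (F E : ℝ → Mat n) (h0 : F 0 = 1) (hadd : ∀ s t, F (s + t) = F s * F t)
    (hE1 : ∀ t, 0 ≤ t → E t = F t) (hE2 : ∀ t, t ≤ 0 → E t = (F (-t))ᴴ) (s t : ℝ) :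
    (E s)ᴴ * ((F (-(max (min s t) 0)))ᴴ * F (-(max (min s t) 0)) +
      (F (-(max (min (-s) (-t)) 0)) * (F (-(max (min (-s) (-t)) 0)))ᴴ - 1)) * E t = E (t - s) := by
  have hi : ∀ a b : ℝ, F a * F b = F (a + b) := fun a b => (hadd a b).symm
  have hi' : ∀ a b : ℝ, (F a)ᴴ * (F b)ᴴ = (F (b + a))ᴴ := fun a b => by
    rw [hadd, Matrix.conjTranspose_mul]
  rcases le_total 0 s with hs | hs <;> rcases le_total 0 t with ht | ht
  · have h1 : max (min (-s) (-t)) 0 = 0 := max_eq_right (min_le_of_left_le (by linarith))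
    have h2 : max (min s t) 0 = min s t := max_eq_left (le_min hs ht)
    rw [h1, h2, hE1 s hs, hE1 t ht]
    simp only [neg_zero, h0, Matrix.conjTranspose_one, mul_one, sub_self, add_zero]
    have : (F s)ᴴ * ((F (-min s t))ᴴ * F (-min s t)) * F t =
      ((F s)ᴴ * (F (-min s t))ᴴ) * (F (-min s t) * F t) := by noncomm_ring
    rw [this, hi, hi']
    rcases le_total s t with h | h
    · rw [min_eq_left h, hE1 _ (by linarith)]
      simp [h0, sub_eq_neg_add]
    · rw [min_eq_right h, hE2 _ (by linarith)]
      simp [h0, sub_eq_neg_add, add_comm]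
  · have h1 : max (min (-s) (-t)) 0 = 0 := max_eq_right (min_le_of_left_le (by linarith))
    have h2 : max (min s t) 0 = 0 := max_eq_right (min_le_of_right_le ht)
    rw [h1, h2, hE1 s hs, hE2 t ht, hE2 _ (by linarith)]
    simp only [neg_zero, h0, Matrix.conjTranspose_one, mul_one, sub_self, add_zero]
    rw [hi']
    congr 2; ring
  · have h1 : max (min (-s) (-t)) 0 = 0 := max_eq_right (min_le_of_right_le (by linarith))
    have h2 : max (min s t) 0 = 0 := max_eq_right (min_le_of_left_le hs)
    rw [h1, h2, hE2 s hs, hE1 t ht, hE1 _ (by linarith)]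
    simp only [neg_zero, h0, Matrix.conjTranspose_one, mul_one, sub_self, add_zero,
      Matrix.conjTranspose_conjTranspose]
    rw [hi]
    congr 1; ring
  · have h1 : max (min (-s) (-t)) 0 = min (-s) (-t) :=
      max_eq_left (le_min (by linarith) (by linarith))
    have h2 : max (min s t) 0 = 0 := max_eq_right (min_le_of_left_le hs)
    rw [h1, h2, hE2 s hs, hE2 t ht]
    simp only [neg_zero, h0, Matrix.conjTranspose_one, mul_one, add_sub_cancel,
      Matrix.conjTranspose_conjTranspose]
    have : F (-s) * (F (-min (-s) (-t)) * (F (-min (-s) (-t)))ᴴ) * (F (-t))ᴴ =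
      (F (-s) * F (-min (-s) (-t))) * ((F (-min (-s) (-t)))ᴴ * (F (-t))ᴴ) := by noncomm_ring
    rw [this, hi, hi']
    rcases le_total s t with h | h
    · rw [min_eq_right (neg_le_neg h), hE1 _ (by linarith)]
      simp [h0, sub_eq_neg_add]
    · rw [min_eq_left (neg_le_neg h), hE2 _ (by linarith)]
      simp [h0, sub_eq_neg_add, add_comm]

theorem kernel_exists {n : ℕ} (T : ℝ → Mat n →ₗ[ℂ] Mat n) (L : Mat n →ₗ[ℂ] Mat n)
    (hT0 : ∀ A, T 0 A = A) (hL : ∀ t, 0 ≤ t → ∀ A, MD (fun s => T s A) (L (T t A)) t)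
    (hTcp : ∀ t : ℝ, 0 ≤ t → IsCompletelyPositive (T t))
    (hTunital : ∀ t : ℝ, 0 ≤ t → T t 1 = 1) :
    ∃ (E : ℝ → Mat n) (R : Matrix (ℝ × (Fin n × Fin n)) (ℝ × (Fin n × Fin n)) ℂ),
      R.PosSemidef ∧ E 0 = 1 ∧ (∀ i j, ContinuousAt (fun t => E t i j) 0) ∧
      (∀ s t, (E s)ᴴ * (Matrix.of fun j k => ∑ a, ∑ b, (1 : Mat n) a b * R (s, a, j) (t, b, k)) * E t
        = E (t - s)) ∧
      (∀ t, 0 ≤ t → ∀ A : Mat n, (E t)ᴴ *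
        (Matrix.of fun j k => ∑ a, ∑ b, A a b * R (t, a, j) (t, b, k)) * E t = T t A) ∧
      ∀ p q, R (0, p) (0, q) = om n p * om n q := by
  obtain ⟨G, Ψ, hG, hΨ, hGp⟩ := gks (fun t => T t) L hT0 hL hTcp hTunital
  obtain ⟨F, hF0, hFadd, hFG, hFd, hFc⟩ := exp2 G
  obtain ⟨R, hR, hRA, hR0⟩ := kernel_pre T F hF0 hT0
    (fun s t hs hst => X_mono T L Ψ G hL hTcp hG hΨ F hFd hs hst)
    (fun s t hs hst => Y_mono G hGp F hFd hFG hs hst)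
  obtain ⟨E, hE⟩ : ∃ E : ℝ → Mat n, E = fun t => if 0 ≤ t then F t else (F (-t))ᴴ := ⟨_, rfl⟩
  have hE1 : ∀ t, 0 ≤ t → E t = F t := fun t ht => by rw [hE]; simp [ht]
  have hE2 : ∀ t, t ≤ 0 → E t = (F (-t))ᴴ := fun t ht => by
    rcases ht.eq_or_lt with h | h
    · rw [h, hE1 0 le_rfl]; simp [hF0]
    · rw [hE]; simp [h]
  refine ⟨E, R, hR, by rw [hE1 0 le_rfl, hF0], fun i j => ?_, fun s t => ?_, fun t ht A => ?_, hR0⟩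
  · have : (fun t => E t i j) = fun t => if 0 ≤ t then F t i j else star (F (-t) j i) := by
      funext t; rw [hE]; dsimp only; split_ifs <;> rfl
    rw [this]
    refine (Continuous.if_le (hFc i j) ?_ continuous_const continuous_id ?_).continuousAt
    · exact continuous_star.comp ((hFc j i).comp continuous_neg)
    · intro x hx
      have hx : x = 0 := hx.symm
      rw [hx, neg_zero, hF0]
      simp [Matrix.one_apply, eq_comm]
  · rw [← E_stat F E hF0 hFadd hE1 hE2]
    congr 2
    ext j k
    rw [Matrix.of_apply, hRA, hTunital _ (le_max_right _ _)]
    have hn : (n : ℂ) ≠ 0 := by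
      have := j.pos
      exact_mod_cast this.ne'
    simp [Matrix.trace_one, hn]
  · have h1 : max (min (-t) (-t)) 0 = 0 := max_eq_right (by simp [ht])
    have h2 : max (min t t) 0 = t := by simp [ht]
    have : (Matrix.of fun j k => ∑ a, ∑ b, A a b * R (t, a, j) (t, b, k)) =
        (F (-t))ᴴ * T t A * F (-t) := by
      ext j k
      rw [Matrix.of_apply, hRA, h1, h2]
      simp [hF0]
    rw [this, hE1 t ht]
    have h3 : (F t)ᴴ * ((F (-t))ᴴ * T t A * F (-t)) * F t =
      (F (-t) * F t)ᴴ * T t A * (F (-t) * F t) := by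
      rw [Matrix.conjTranspose_mul]; noncomm_ring
    rw [h3, ← hFadd]
    simp [hF0]

section rep
variable {H : Type} [NormedAddCommGroup H] [InnerProductSpace ℂ H]

/-- matrix action on a finite direct sum of copies of a Hilbert space -/
noncomputable def repC {n : ℕ} (A : Mat n) :
    PiLp 2 (fun _ : Fin n => H) →L[ℂ] PiLp 2 (fun _ : Fin n => H) :=
  ((PiLp.continuousLinearEquiv 2 ℂ (fun _ : Fin n => H)).symm.toContinuousLinearMap).comp
    ((ContinuousLinearMap.pi fun i => ∑ j, A i j • ContinuousLinearMap.proj (R := ℂ)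
      (φ := fun _ : Fin n => H) j).comp
      (PiLp.continuousLinearEquiv 2 ℂ (fun _ : Fin n => H)).toContinuousLinearMap)

theorem repC_apply {n : ℕ} (A : Mat n) (f : PiLp 2 (fun _ : Fin n => H)) (i : Fin n) :
    repC A f i = ∑ j, A i j • f j := by
  simp [repC]

theorem repC_inner {n : ℕ} (A : Mat n) (f g : PiLp 2 (fun _ : Fin n => H)) :
    inner ℂ f (repC A g) = ∑ a, ∑ b, A a b * inner ℂ (f a) (g b) := by
  simp [PiLp.inner_apply, repC_apply, inner_sum, inner_smul_right]

/-- the star representation -/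
noncomputable def repS (n : ℕ) [CompleteSpace H] :
    Mat n →⋆ₐ[ℂ] (PiLp 2 (fun _ : Fin n => H) →L[ℂ] PiLp 2 (fun _ : Fin n => H)) where
  toFun := repC
  map_one' := by
    ext f i
    simp [repC_apply, Matrix.one_apply]
  map_mul' A B := by
    ext f i
    change _ = repC A (repC B f) i
    simp only [repC_apply, Matrix.mul_apply, Finset.sum_smul, Finset.smul_sum, smul_smul]
    rw [Finset.sum_comm]
  map_zero' := by
    ext f i
    simp [repC_apply]
  map_add' A B := by
    ext f i
    simp [repC_apply, add_smul, Finset.sum_add_distrib]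
  commutes' r := by
    ext f i
    simp [repC_apply, Matrix.algebraMap_matrix_apply]
  map_star' A := by
    rw [ContinuousLinearMap.star_eq_adjoint, ContinuousLinearMap.eq_adjoint_iff]
    intro f g
    rw [repC_inner, ← inner_conj_symm, repC_inner]
    simp only [map_sum, map_mul, Matrix.star_apply, inner_conj_symm]
    rw [Finset.sum_comm]
    simp

/-- the cyclic vectors -/
noncomputable def vv {n : ℕ} (E : ℝ → Mat n) (l : ℝ × (Fin n × Fin n) → H) (t : ℝ) (i : Fin n) :
    PiLp 2 (fun _ : Fin n => H) :=
  WithLp.toLp 2 fun a => ∑ j, E t j i • l (t, a, j)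

theorem sum4 {n : ℕ} (f : Fin n → Fin n → Fin n → Fin n → ℂ) :
    ∑ a, ∑ b, ∑ k, ∑ j, f a b k j = ∑ k, ∑ j, ∑ a, ∑ b, f a b k j := by
  have h1 : ∀ a, ∑ b, ∑ k, ∑ j, f a b k j = ∑ k, ∑ j, ∑ b, f a b k j := fun a => by
    rw [Finset.sum_comm]
    exact Finset.sum_congr rfl fun k _ => Finset.sum_comm
  rw [Finset.sum_congr rfl fun a _ => h1 a, Finset.sum_comm]
  exact Finset.sum_congr rfl fun k _ => Finset.sum_comm

theorem vv_inner {n : ℕ} (E : ℝ → Mat n) (l : ℝ × (Fin n × Fin n) → H)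
    (R : Matrix (ℝ × (Fin n × Fin n)) (ℝ × (Fin n × Fin n)) ℂ)
    (hl : ∀ x y, inner ℂ (l x) (l y) = R x y) (s t : ℝ) (i k : Fin n) (A : Mat n) :
    inner ℂ (vv E l s i) (repC A (vv E l t k)) =
      ((E s)ᴴ * (Matrix.of fun j k => ∑ a, ∑ b, A a b * R (s, a, j) (t, b, k)) * E t) i k := by
  rw [repC_inner]
  simp only [vv, sum_inner, inner_sum, inner_smul_left, inner_smul_right, hl, Matrix.mul_apply,
    Matrix.of_apply, Matrix.conjTranspose_apply, Finset.mul_sum, Finset.sum_mul]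
  rw [sum4]
  refine Finset.sum_congr rfl fun x _ => Finset.sum_congr rfl fun y _ => Finset.sum_congr rfl
    fun z _ => Finset.sum_congr rfl fun u _ => ?_
  rw [starRingEnd_apply]
  ring

theorem vv_cont {n : ℕ} (E : ℝ → Mat n) (hE0 : E 0 = 1)
    (hEc : ∀ i j, ContinuousAt (fun t => E t i j) 0)
    {K : Type} [NormedAddCommGroup K] [InnerProductSpace ℂ K] (v : ℝ → Fin n → K)
    (hv : ∀ s t i j, inner ℂ (v s i) (v t j) = E (t - s) i j) (i : Fin n) :
    Continuous fun t => v t i := by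
  refine continuous_iff_continuousAt.2 fun s => ?_
  rw [ContinuousAt, tendsto_iff_norm_sub_tendsto_zero]
  have h1 : ∀ t, ‖v t i‖ ^ 2 = 1 := fun t => by
    rw [← inner_self_eq_norm_sq (𝕜 := ℂ), hv]
    simp [hE0]
  have h2 : ∀ t, ‖v t i - v s i‖ = Real.sqrt (2 - 2 * (E (s - t) i i).re) := fun t => by
    rw [← Real.sqrt_sq (norm_nonneg (v t i - v s i)), @norm_sub_sq ℂ, h1, h1, hv]
    congr 1
    simp
    ring
  simp only [h2]
  have h3 : ContinuousAt (fun t => E (s - t) i i) s := by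
    refine ContinuousAt.comp (f := fun t => s - t) (g := fun t => E t i i) ?_ (by fun_prop)
    simpa using hEc i i
  have h4 : ContinuousAt (fun t => Real.sqrt (2 - 2 * (E (s - t) i i).re)) s := by
    exact (continuousAt_const.sub (continuousAt_const.mul (Complex.continuous_re.continuousAt.comp h3))).sqrt
  have := h4.tendsto
  simpa [hE0] using this

theorem l_zero {n : ℕ} (l : (Fin n × Fin n) → H)
    (hl : ∀ p q, inner ℂ (l p) (l q) = om n p * om n q) (p q : Fin n × Fin n) :
    om n q • l p = om n p • l q := by
  rw [← sub_eq_zero, ← inner_self_eq_zero (𝕜 := ℂ)]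
  have hr : ∀ p, (starRingEnd ℂ) (om n p) = om n p := fun p => congrFun (om_real n) p
  simp only [inner_sub_left, inner_sub_right, inner_smul_left, inner_smul_right, hl, hr]
  ring

theorem vv_intertwine {n : ℕ} (E : ℝ → Mat n) (hE0 : E 0 = 1) (l : ℝ × (Fin n × Fin n) → H)
    (hl : ∀ p q, inner ℂ (l (0, p)) (l (0, q)) = om n p * om n q) (A : Mat n) (i : Fin n) :
    repC A (vv E l 0 i) = ∑ j, A j i • vv E l 0 j := by
  have h0 : ∀ i a, vv E l 0 i a = l (0, a, i) := fun i a => by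
    simp [vv, hE0, Matrix.one_apply]
  have h := l_zero (fun p => l (0, p)) hl
  have h1 : ∀ a b i, l (0, b, i) = om n (b, i) • l (0, a, a) := fun a b i => by
    have := h (b, i) (a, a)
    simpa [om] using this
  ext a
  have e1 : repC A (vv E l 0 i) a = ∑ b, A a b • (om n (b, i) • l (0, a, a)) := by
    rw [repC_apply]
    exact Finset.sum_congr rfl fun b _ => by rw [h0, h1 a b i]
  have e2 : (∑ j, A j i • vv E l 0 j) a = ∑ j, A j i • (om n (a, j) • l (0, a, a)) := by
    rw [WithLp.ofLp_sum, Finset.sum_apply]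
    exact Finset.sum_congr rfl fun b _ => by rw [PiLp.smul_apply, h0, h1 a a b]
  rw [e1, e2]
  simp [om]

end rep

/-- **Davies' dilation theorem** (finite-dimensional system): every norm-continuous
one-parameter semigroup of completely positive unital maps on `Mₙ(ℂ)` is the compression,
by an intertwining isometry `J` into a Hilbert space carrying a unital `*`-representation
`π` of `Mₙ(ℂ)`, of conjugation by a strongly continuous one-parameter unitary group:
`T_t(A) = J* V_t* π(A) V_t J` for all `t ≥ 0`. -/
theorem exists_davies_dilation
    {n : ℕ}
    (T : ℝ → (Matrix (Fin n) (Fin n) ℂ →L[ℂ] Matrix (Fin n) (Fin n) ℂ))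
    (hT0 : T 0 = ContinuousLinearMap.id ℂ (Matrix (Fin n) (Fin n) ℂ))
    (hTadd : ∀ s t : ℝ, 0 ≤ s → 0 ≤ t → T (s + t) = (T s).comp (T t))
    (hTcont : ContinuousOn T (Set.Ici (0 : ℝ)))
    (hTcp : ∀ t : ℝ, 0 ≤ t → IsCompletelyPositive (⇑(T t)))
    (hTunital : ∀ t : ℝ, 0 ≤ t → T t 1 = 1) :
    Nonempty (DaviesDilation n T) := by
  obtain ⟨L, hL⟩ := gen_exists T hT0 hTadd hTcont
  obtain ⟨E, R, hR, hE0, hEc, hst, hdil, hR0⟩ := kernel_exists (fun t => (T t).toLinearMap) L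
    (fun A => by rw [hT0]; rfl) hL hTcp hTunital
  obtain ⟨H, i1, i2, i3, l, hl⟩ := kol R hR
  have hin := vv_inner E l R hl
  have hvv : ∀ s t i j, inner ℂ (vv E l s i) (vv E l t j) = E (t - s) i j := by
    intro s t i j
    have h := hin s t i j 1
    rw [hst] at h
    have h1 : repC (1 : Mat n) (vv E l t j) = vv E l t j :=
      congrArg (fun f : PiLp 2 (fun _ : Fin n => H) →L[ℂ] PiLp 2 (fun _ : Fin n => H) =>
        f (vv E l t j)) (map_one (repS (H := H) n))
    rwa [h1] at h
  obtain ⟨V, hV1, hV2, hV3, hV4, hV5⟩ := unitary_group_exists (vv E l)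
    (fun s t u i j => by rw [hvv, hvv]; congr 1; ring_nf) (vv_cont E hE0 hEc (vv E l) hvv)
  have hon : Orthonormal ℂ (vv E l 0) := by
    rw [orthonormal_iff_ite]
    intro i j
    rw [hvv, sub_self, hE0, Matrix.one_apply]
  let J0 : EuclideanSpace ℂ (Fin n) →ₗ[ℂ] PiLp 2 (fun _ : Fin n => H) :=
    { toFun := fun x => ∑ i, x i • vv E l 0 i
      map_add' := fun x y => by simp [add_smul, Finset.sum_add_distrib]
      map_smul' := fun c x => by simp [smul_smul, Finset.smul_sum] }
  have hJ0 : ∀ x, J0 x = ∑ i, x i • vv E l 0 i := fun x => rfl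
  let J : EuclideanSpace ℂ (Fin n) →ₗᵢ[ℂ] PiLp 2 (fun _ : Fin n => H) :=
    J0.isometryOfInner fun x y => by
      rw [hJ0, hJ0, hon.inner_sum]
      simp [PiLp.inner_apply, mul_comm]
  have hJ : ∀ x, J x = ∑ i, x i • vv E l 0 i := fun x => rfl
  have hmat : ∀ (A : Mat n) (x : EuclideanSpace ℂ (Fin n)) i,
      Matrix.toEuclideanLin A x i = ∑ j, A i j * x j := fun A x i => by
    simp [Matrix.mulVec, dotProduct]
  refine ⟨{ K := PiLp 2 (fun _ : Fin n => H), rep := repS n, J := J, V := V, V_unitary := hV1,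
            V_zero := hV2, V_add := hV3, V_strongly_continuous := hV4,
            intertwine := ?_, dilation := ?_ }⟩
  · intro A x
    change repC A (J x) = _
    rw [hJ, hJ, map_sum]
    simp only [map_smul, vv_intertwine E hE0 l (fun p q => by rw [hl, hR0]), hmat, Finset.smul_sum,
      Finset.sum_smul, smul_smul]
    rw [Finset.sum_comm]
    simp only [mul_comm]
  · intro t ht A x
    refine ext_inner_left ℂ fun y => ?_
    rw [ContinuousLinearMap.adjoint_inner_right, ContinuousLinearMap.adjoint_inner_right]
    change _ = inner ℂ (V t (J y)) (repC A (V t (J x)))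
    rw [hJ, hJ]
    simp only [map_sum, map_smul, hV5, zero_add, sum_inner, inner_sum, inner_smul_left,
      inner_smul_right, hin]
    have h := hdil t ht A
    rw [h]
    simp only [PiLp.inner_apply, hmat, RCLike.inner_apply, Finset.sum_mul]
    rw [Finset.sum_comm]
    refine Finset.sum_congr rfl fun i _ => ?_
    rw [Finset.mul_sum]
    refine Finset.sum_congr rfl fun j _ => ?_
    change T t A _ _ * _ * _ = _ * (_ * T t A _ _)
    ring
end
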